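/- arXiv:1807.08801 — 5 statements merged into one kernel-verified Lean document; each statement's English description precedes it below -/
import Mathlib

section
/- Let S : ℤ → 𝕊² satisfy −1 < S_n·S_{n+1} < 1 for all n ∈ ℤ, and let θ_n ∈ (0,π) and γ_n ∈ (−π,π] be the associated angle coordinates. Then for all n ∈ ℤ: (i) S_{n+1} = cos(θ_n) S_n + (sin(θ_n)/sin(θ_{n−1})) [ sin(γ_n) (S_{n−1} × S_n) + cos(γ_n) ((S_{n−1} × S_n) × S_n) ]; (ii) S_{n−1} = cos(θ_{n−1}) S_n + (sin(θ_{n−1})/sin(θ_n)) [ sin(γ_n) (S_n × S_{n+1}) − cos(γ_n) ((S_n × S_{n+1}) × S_n) ]; (iii) S_n·S_{n+1} = cos(θ_n); (iv) S_n·S_{n+2} = cos(θ_n)cos(θ_{n+1}) − sin(θ_{n+1})sin(θ_n)cos(γ_{n+1}); (v) S_n·S_{n+3} = cos(θ_n)[cos(θ_{n+1})cos(θ_{n+2}) − cos(γ_{n+2})sin(θ_{n+1})sin(θ_{n+2})] + { −[sin(θ_{n+1})cos(θ_{n+2}) + cos(θ_{n+1})sin(θ_{n+2})cos(γ_{n+2})]cos(γ_{n+1})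 + sin(θ_{n+2})sin(γ_{n+1})sin(γ_{n+2}) } sin(θ_n). -/
open Matrix
noncomputable section

theorem key_a (a b c : Fin 3 → ℝ) :
    ((b ⬝ᵥ b) * (crossProduct a b ⬝ᵥ crossProduct a b)) • c
      = ((b ⬝ᵥ c) * (crossProduct a b ⬝ᵥ crossProduct a b)) • b
        + ((a ⬝ᵥ crossProduct b c) * (b ⬝ᵥ b)) • crossProduct a b
        + (crossProduct a b ⬝ᵥ crossProduct b c) • crossProduct (crossProduct a b) b := by
  ext i
  simp only [Pi.add_apply, Pi.sub_apply, Pi.smul_apply, smul_eq_mul]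
  fin_cases i <;> simp [cross_apply, dotProduct, Fin.sum_univ_three] <;> ring

theorem key_b (a b c : Fin 3 → ℝ) :
    ((b ⬝ᵥ b) * (crossProduct b c ⬝ᵥ crossProduct b c)) • a
      = ((a ⬝ᵥ b) * (crossProduct b c ⬝ᵥ crossProduct b c)) • b
        + ((a ⬝ᵥ crossProduct b c) * (b ⬝ᵥ b)) • crossProduct b c
        - (crossProduct a b ⬝ᵥ crossProduct b c) • crossProduct (crossProduct b c) b := by
  ext i
  simp only [Pi.add_apply, Pi.sub_apply, Pi.smul_apply, smul_eq_mul]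
  fin_cases i <;> simp [cross_apply, dotProduct, Fin.sum_univ_three] <;> ring

theorem key_n (a b : Fin 3 → ℝ) (t : ℝ) (ha : a ⬝ᵥ a = 1) (hb : b ⬝ᵥ b = 1)
    (h : Real.cos t = a ⬝ᵥ b) :
    crossProduct a b ⬝ᵥ crossProduct a b = Real.sin t ^ 2 := by
  rw [cross_dot_cross, ha, hb, dotProduct_comm b a, ← h, Real.sin_sq]; ring

theorem key_c (a b d : Fin 3 → ℝ) :
    d ⬝ᵥ crossProduct (crossProduct a b) b = (a ⬝ᵥ b) * (d ⬝ᵥ b) - (b ⬝ᵥ b) * (d ⬝ᵥ a) := by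
  simp [cross_apply, dotProduct, Fin.sum_univ_three]; ring

/-- reconstruction of the spin chain from the angle coordinates θ_n ∈ (0,π),
γ_n ∈ (−π,π], defined by cos θ_n = S_n·S_{n+1} and
sin θ_{n−1} sin θ_n e^{iγ_n} = (S_{n−1}×S_n)·(S_n×S_{n+1}) + i S_{n−1}·(S_n×S_{n+1}),
together with the formulas for S_n·S_{n+1}, S_n·S_{n+2} and S_n·S_{n+3}. -/
theorem spin_reconstruction
    (S : ℤ → Fin 3 → ℝ)
    (hunit : ∀ n : ℤ, S n ⬝ᵥ S n = 1)
    (hdot : ∀ n : ℤ, S n ⬝ᵥ S (n+1) ∈ Set.Ioo (-1 : ℝ) 1)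
    (θ γ : ℤ → ℝ)
    (hθ : ∀ n : ℤ, θ n ∈ Set.Ioo (0 : ℝ) Real.pi)
    (hγ : ∀ n : ℤ, γ n ∈ Set.Ioc (-Real.pi) Real.pi)
    (hθdef : ∀ n : ℤ, Real.cos (θ n) = S n ⬝ᵥ S (n+1))
    (hγdef : ∀ n : ℤ,
      ((Real.sin (θ (n-1)) * Real.sin (θ n) : ℝ) : ℂ) * Complex.exp (Complex.I * (γ n : ℝ))
        = (((crossProduct (S (n-1)) (S n)) ⬝ᵥ (crossProduct (S n) (S (n+1))) : ℝ) : ℂ)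
          + ((S (n-1) ⬝ᵥ crossProduct (S n) (S (n+1)) : ℝ) : ℂ) * Complex.I) :
    ∀ n : ℤ,
      (S (n+1) = Real.cos (θ n) • S n
          + (Real.sin (θ n) / Real.sin (θ (n-1))) •
            (Real.sin (γ n) • crossProduct (S (n-1)) (S n)
              + Real.cos (γ n) • crossProduct (crossProduct (S (n-1)) (S n)) (S n)))
      ∧ (S (n-1) = Real.cos (θ (n-1)) • S n
          + (Real.sin (θ (n-1)) / Real.sin (θ n)) •
            (Real.sin (γ n) • crossProduct (S n) (S (n+1))
              - Real.cos (γ n) • crossProduct (crossProduct (S n) (S (n+1))) (S n)))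
      ∧ (S n ⬝ᵥ S (n+1) = Real.cos (θ n))
      ∧ (S n ⬝ᵥ S (n+2)
          = Real.cos (θ n) * Real.cos (θ (n+1))
            - Real.sin (θ (n+1)) * Real.sin (θ n) * Real.cos (γ (n+1)))
      ∧ (S n ⬝ᵥ S (n+3)
          = Real.cos (θ n) * (Real.cos (θ (n+1)) * Real.cos (θ (n+2))
              - Real.cos (γ (n+2)) * Real.sin (θ (n+1)) * Real.sin (θ (n+2)))
            + (-((Real.sin (θ (n+1)) * Real.cos (θ (n+2))
                  + Real.cos (θ (n+1)) * Real.sin (θ (n+2)) * Real.cos (γ (n+2)))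
                    * Real.cos (γ (n+1)))
                + Real.sin (θ (n+2)) * Real.sin (γ (n+1)) * Real.sin (γ (n+2)))
              * Real.sin (θ n)) := by
  have hs : ∀ n, Real.sin (θ n) ≠ 0 := fun n =>
    (Real.sin_pos_of_pos_of_lt_pi (hθ n).1 (hθ n).2).ne'
  have hre : ∀ n, crossProduct (S (n-1)) (S n) ⬝ᵥ crossProduct (S n) (S (n+1))
      = Real.sin (θ (n-1)) * Real.sin (θ n) * Real.cos (γ n) := by
    intro n
    have h := congrArg Complex.re (hγdef n)
    rw [mul_comm Complex.I, Complex.re_ofReal_mul, Complex.exp_ofReal_mul_I_re] at h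
    rw [h]; simp
  have him : ∀ n, S (n-1) ⬝ᵥ crossProduct (S n) (S (n+1))
      = Real.sin (θ (n-1)) * Real.sin (θ n) * Real.sin (γ n) := by
    intro n
    have h := congrArg Complex.im (hγdef n)
    rw [mul_comm Complex.I, Complex.im_ofReal_mul, Complex.exp_ofReal_mul_I_im] at h
    rw [h]; simp
  have hθ' : ∀ n, Real.cos (θ (n-1)) = S (n-1) ⬝ᵥ S n := by
    intro n; have := hθdef (n-1); rwa [sub_add_cancel] at this
  have h1 : ∀ n, S (n+1) = Real.cos (θ n) • S n
          + (Real.sin (θ n) / Real.sin (θ (n-1))) •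
            (Real.sin (γ n) • crossProduct (S (n-1)) (S n)
              + Real.cos (γ n) • crossProduct (crossProduct (S (n-1)) (S n)) (S n)) := by
    intro n
    have k := key_a (S (n-1)) (S n) (S (n+1))
    rw [hre, him, key_n _ _ _ (hunit _) (hunit _) (hθ' n), hunit, ← hθdef] at k
    have e := hs (n-1)
    ext i
    have ki := congrFun k i
    simp only [Pi.add_apply, Pi.smul_apply, smul_eq_mul] at ki ⊢
    field_simp
    apply mul_left_cancel₀ e
    linear_combination ki
  have h2 : ∀ n, S (n-1) = Real.cos (θ (n-1)) • S n
          + (Real.sin (θ (n-1)) / Real.sin (θ n)) •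
            (Real.sin (γ n) • crossProduct (S n) (S (n+1))
              - Real.cos (γ n) • crossProduct (crossProduct (S n) (S (n+1))) (S n)) := by
    intro n
    have k := key_b (S (n-1)) (S n) (S (n+1))
    rw [hre, him, key_n _ _ _ (hunit _) (hunit _) (hθdef n), hunit, ← hθ'] at k
    have e := hs n
    ext i
    have ki := congrFun k i
    simp only [Pi.add_apply, Pi.sub_apply, Pi.smul_apply, smul_eq_mul] at ki ⊢
    field_simp
    apply mul_left_cancel₀ e
    linear_combination ki
  have h4 : ∀ n, S n ⬝ᵥ S (n+2)
          = Real.cos (θ n) * Real.cos (θ (n+1))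
            - Real.sin (θ (n+1)) * Real.sin (θ n) * Real.cos (γ (n+1)) := by
    intro n
    have h := hre (n+1)
    rw [cross_dot_cross, hunit, ← hθ', ← hθdef, add_sub_cancel_right,
      show n + 1 + 1 = n + 2 by ring] at h
    linear_combination -h
  intro n
  refine ⟨h1 n, h2 n, (hθdef n).symm, h4 n, ?_⟩
  have h := h1 (n+2)
  have hi := him (n+1)
  have hc := hθdef (n+1)
  have h4n := h4 n
  have hsc := Real.sin_sq_add_cos_sq (θ (n+1))
  have e := hs (n+1)
  rw [show n + 2 + 1 = n + 3 by ring, show n + 2 - 1 = n + 1 by ring] at h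
  rw [show n + 1 + 1 = n + 2 by ring, show n + 1 - 1 = n by ring] at hi
  rw [show n + 1 + 1 = n + 2 by ring] at hc
  rw [h]
  simp only [dotProduct_add, dotProduct_smul, smul_eq_mul]
  rw [key_c, hi, hunit, ← hc, h4n, ← hθdef]
  field_simp
  linear_combination (Real.sin (θ (n+2)) * Real.cos (γ (n+2)) * Real.cos (θ n)) * hsc
end
end

section
/- For every a ∈ ℓ²(ℤ,ℂ) there exists a unique continuously differentiable curve α : ℝ → ℓ²(ℤ,ℂ) with α(0) = a satisfying, for every n ∈ ℤ and t ∈ ℝ, i·(d/dt)α_n(t) = −(1+|α_n(t)|²)(α_{n+1}(t)+α_{n−1}(t)) + 2α_n(t). Moreover, for this solution the quantity Σ_{n∈ℤ} 2 log(1+|α_n(t)|²) is finite and independent of t. -/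
open scoped BigOperators
noncomputable section

/-- The Hilbert space ℓ²(ℤ,ℂ). -/
abbrev l2Z := lp (fun _ : ℤ => ℂ) 2

/-- A curve `α : ℝ → ℓ²(ℤ,ℂ)` satisfies the focusing Ablowitz–Ladik system:
for every n and t, i·(d/dt)α_n(t) = −(1+|α_n(t)|²)(α_{n+1}(t)+α_{n−1}(t)) + 2α_n(t). -/
def ALl2Equation (α : ℝ → l2Z) : Prop :=
  ∀ (n : ℤ) (t : ℝ), ∃ d : ℂ,
    HasDerivAt (fun s : ℝ => α s n) d t ∧
    Complex.I * d
      = -(1 + (Complex.normSq (α t n) : ℂ)) * (α t (n+1) + α t (n-1)) + 2 * α t n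

open Filter Topology MeasureTheory

theorem two_pos' : 0 < (2 : ENNReal).toReal := by norm_num

theorem l2_summable (x : l2Z) : Summable (fun n : ℤ => ‖x n‖ ^ 2) := by
  have := (lp.memℓp x).summable two_pos'
  simpa using this

theorem l2_norm_sq (x : l2Z) : ‖x‖ ^ 2 = ∑' n : ℤ, ‖x n‖ ^ 2 := by
  have := lp.norm_rpow_eq_tsum two_pos' x
  simpa using this

theorem l2_mem {f : ℤ → ℂ} (h : Summable (fun n : ℤ => ‖f n‖ ^ 2)) : Memℓp f 2 := by
  apply memℓp_gen
  simpa using h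

theorem sum_shift (x : l2Z) (k : ℤ) : Summable (fun n : ℤ => ‖x (n + k)‖ ^ 2) :=
  (Equiv.addRight k).summable_iff.mpr (l2_summable x)

theorem tsum_shift (x : l2Z) (k : ℤ) : ∑' n : ℤ, ‖x (n + k)‖ ^ 2 = ‖x‖ ^ 2 := by
  rw [l2_norm_sq]
  exact (Equiv.addRight k).tsum_eq (fun n : ℤ => ‖x n‖ ^ 2)

/-- shifted absolute value -/
def ash (x : l2Z) (k : ℤ) : l2Z :=
  ⟨fun n => ((‖x (n + k)‖ : ℝ) : ℂ), l2_mem (by simpa using sum_shift x k)⟩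

theorem ash_apply (x : l2Z) (k n : ℤ) : ash x k n = ((‖x (n + k)‖ : ℝ) : ℂ) := rfl

theorem norm_ash (x : l2Z) (k : ℤ) : ‖ash x k‖ = ‖x‖ := by
  have h : ‖ash x k‖ ^ 2 = ‖x‖ ^ 2 := by
    rw [l2_norm_sq, ← tsum_shift x k]
    simp [ash_apply]
  exact (pow_left_inj₀ (norm_nonneg _) (norm_nonneg _) two_ne_zero).mp h

def domi (x : l2Z) (A B : ℝ) : l2Z := A • ash x 1 + A • ash x (-1) + B • ash x 0

theorem domi_apply (x : l2Z) (A B : ℝ) (n : ℤ) :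
    domi x A B n = ((A * ‖x (n+1)‖ + A * ‖x (n-1)‖ + B * ‖x n‖ : ℝ) : ℂ) := by
  change A • ash x 1 n + A • ash x (-1) n + B • ash x 0 n = _
  simp [ash_apply, sub_eq_add_neg]

theorem norm_domi (x : l2Z) {A B : ℝ} (hA : 0 ≤ A) (hB : 0 ≤ B) :
    ‖domi x A B‖ ≤ (2 * A + B) * ‖x‖ := by
  have h1 := norm_add₃_le (a := A • ash x 1) (b := A • ash x (-1)) (c := B • ash x 0)
  simp only [norm_smul, norm_ash, Real.norm_of_nonneg hA, Real.norm_of_nonneg hB] at h1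
  unfold domi
  linarith

theorem norm_domi_apply (x : l2Z) {A B : ℝ} (hA : 0 ≤ A) (hB : 0 ≤ B) (n : ℤ) :
    ‖domi x A B n‖ = A * ‖x (n+1)‖ + A * ‖x (n-1)‖ + B * ‖x n‖ := by
  rw [domi_apply, Complex.norm_real, Real.norm_of_nonneg (by positivity)]

theorem mem_domi (x : l2Z) {A B : ℝ} (hA : 0 ≤ A) (hB : 0 ≤ B) {f : ℤ → ℂ}
    (h : ∀ n, ‖f n‖ ≤ A * ‖x (n+1)‖ + A * ‖x (n-1)‖ + B * ‖x n‖) : Memℓp f 2 :=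
  (lp.memℓp (domi x A B)).mono' (fun n => by rw [norm_domi_apply x hA hB]; exact h n)

theorem norm_le_domi (x y : l2Z) {A B : ℝ} (hA : 0 ≤ A) (hB : 0 ≤ B)
    (h : ∀ n, ‖y n‖ ≤ A * ‖x (n+1)‖ + A * ‖x (n-1)‖ + B * ‖x n‖) :
    ‖y‖ ≤ (2 * A + B) * ‖x‖ :=
  (lp.norm_mono two_ne_zero (y := domi x A B)
    (fun n => by rw [norm_domi_apply x hA hB]; exact h n)).trans (norm_domi x hA hB)

theorem coord_le (x : l2Z) (n : ℤ) : ‖x n‖ ≤ ‖x‖ := lp.norm_apply_le_norm two_ne_zero x n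

/-- coordinate field -/
def Fc (x : l2Z) (n : ℤ) : ℂ :=
  Complex.I * ((1 + (Complex.normSq (x n) : ℂ)) * (x (n+1) + x (n-1))) - 2 * Complex.I * x n

theorem Fc_diff (x y : l2Z) {R : ℝ} (hx : ‖x‖ ≤ R) (hy : ‖y‖ ≤ R) (n : ℤ) :
    ‖Fc x n - Fc y n‖ ≤ (1 + R^2) * ‖(x - y) (n+1)‖ + (1 + R^2) * ‖(x - y) (n-1)‖
      + (4 * R^2 + 2) * ‖(x - y) n‖ := by
  have hR : 0 ≤ R := (norm_nonneg _).trans hx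
  have e : Fc x n - Fc y n = Complex.I * ((1 + ((‖x n‖^2 : ℝ) : ℂ)) * ((x - y) (n+1)))
      + Complex.I * ((1 + ((‖x n‖^2 : ℝ) : ℂ)) * ((x - y) (n-1)))
      + (Complex.I * (((‖x n‖^2 - ‖y n‖^2 : ℝ) : ℂ) * (y (n+1) + y (n-1)))
        - 2 * Complex.I * (x - y) n) := by
    simp only [Fc, Complex.normSq_eq_norm_sq, lp.coeFn_sub, Pi.sub_apply]
    push_cast
    ring
  have hxn := (coord_le x n).trans hx
  have hyn := (coord_le y n).trans hy
  have h1 : ‖(1 + ((‖x n‖^2 : ℝ) : ℂ))‖ ≤ 1 + R^2 := by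
    rw [← Complex.ofReal_one, ← Complex.ofReal_add, Complex.norm_real,
      Real.norm_of_nonneg (by positivity)]
    gcongr
  have h2 : ‖((‖x n‖^2 - ‖y n‖^2 : ℝ) : ℂ)‖ ≤ 2 * R * ‖(x - y) n‖ := by
    rw [Complex.norm_real, Real.norm_eq_abs, sq_sub_sq, abs_mul, abs_of_nonneg (by positivity)]
    have := abs_norm_sub_norm_le (x n) (y n)
    have h3 : ‖(x - y) n‖ = ‖x n - y n‖ := by simp
    rw [h3]
    gcongr
    linarith
  have h4 : ‖y (n+1) + y (n-1)‖ ≤ 2 * R := by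
    have := norm_add_le (y (n+1)) (y (n-1))
    have := (coord_le y (n+1)).trans hy
    have := (coord_le y (n-1)).trans hy
    linarith
  rw [e]
  refine (norm_add₃_le).trans ?_
  have g1 : ‖Complex.I * ((1 + ((‖x n‖^2 : ℝ) : ℂ)) * ((x - y) (n+1)))‖
      ≤ (1 + R^2) * ‖(x - y) (n+1)‖ := by
    rw [norm_mul, norm_mul, Complex.norm_I, one_mul]; gcongr
  have g2 : ‖Complex.I * ((1 + ((‖x n‖^2 : ℝ) : ℂ)) * ((x - y) (n-1)))‖
      ≤ (1 + R^2) * ‖(x - y) (n-1)‖ := by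
    rw [norm_mul, norm_mul, Complex.norm_I, one_mul]; gcongr
  have g3 : ‖Complex.I * (((‖x n‖^2 - ‖y n‖^2 : ℝ) : ℂ) * (y (n+1) + y (n-1)))
        - 2 * Complex.I * (x - y) n‖ ≤ (4 * R^2 + 2) * ‖(x - y) n‖ := by
    refine (norm_sub_le _ _).trans ?_
    rw [norm_mul, norm_mul, Complex.norm_I, one_mul, norm_mul, norm_mul, Complex.norm_I]
    have : ‖((‖x n‖^2 - ‖y n‖^2 : ℝ) : ℂ)‖ * ‖y (n+1) + y (n-1)‖
        ≤ (2 * R * ‖(x - y) n‖) * (2 * R) := by gcongr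
    simp only [Complex.norm_ofNat, mul_one]
    nlinarith
  linarith

theorem Fc_zero (n : ℤ) : Fc 0 n = 0 := by simp [Fc]

theorem Fc_mem (x : l2Z) : Memℓp (Fc x) 2 := by
  refine mem_domi x (A := 1 + ‖x‖^2) (B := 4 * ‖x‖^2 + 2) (by positivity) (by positivity) ?_
  intro n
  have := Fc_diff x 0 le_rfl (by simp) n
  simpa [Fc_zero] using this

def F (x : l2Z) : l2Z := ⟨Fc x, Fc_mem x⟩

theorem F_apply (x : l2Z) (n : ℤ) : F x n = Fc x n := rfl

theorem F_lip {x y : l2Z} {R : ℝ} (hx : ‖x‖ ≤ R) (hy : ‖y‖ ≤ R) :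
    ‖F x - F y‖ ≤ (6 * R^2 + 4) * ‖x - y‖ := by
  have := norm_le_domi (x - y) (F x - F y) (A := 1 + R^2) (B := 4 * R^2 + 2)
    (by positivity) (by positivity) (fun n => by
      simpa [F_apply] using Fc_diff x y hx hy n)
  linarith

theorem F_zero : F 0 = 0 := by
  ext n
  simp [F_apply, Fc_zero]

theorem F_norm {x : l2Z} {R : ℝ} (hx : ‖x‖ ≤ R) : ‖F x‖ ≤ (6 * R^2 + 4) * R := by
  have h := F_lip hx (y := 0) (by simpa using (norm_nonneg _).trans hx)
  rw [F_zero, sub_zero, sub_zero] at h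
  exact h.trans (by gcongr)

theorem F_cont : Continuous F := by
  rw [continuous_iff_continuousAt]
  intro x
  have h : LipschitzOnWith (Real.toNNReal (6 * (‖x‖ + 1)^2 + 4)) F (Metric.ball 0 (‖x‖ + 1)) := by
    apply LipschitzOnWith.of_dist_le_mul
    intro y hy z hz
    rw [dist_eq_norm, dist_eq_norm, Real.coe_toNNReal _ (by positivity)]
    rw [mem_ball_zero_iff] at hy hz
    exact F_lip hy.le hz.le
  exact h.continuousOn.continuousAt (Metric.isOpen_ball.mem_nhds (by simp))

/-- cutoff -/
def cut (R : ℝ) (x : l2Z) : ℝ := max 0 (min 1 (R + 1 - ‖x‖))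

theorem cut_cont (R : ℝ) : Continuous (cut R) := by unfold cut; fun_prop

theorem cut_nonneg (R : ℝ) (x : l2Z) : 0 ≤ cut R x := le_max_left _ _

theorem cut_le (R : ℝ) (x : l2Z) : cut R x ≤ 1 := max_le zero_le_one (min_le_left _ _)

theorem cut_one {R : ℝ} {x : l2Z} (h : ‖x‖ ≤ R) : cut R x = 1 := by
  unfold cut
  rw [min_eq_left (by linarith), max_eq_right zero_le_one]

theorem cut_out {R : ℝ} {x : l2Z} (h : R + 1 ≤ ‖x‖) : cut R x = 0 := by
  unfold cut
  rw [max_eq_left]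
  exact (min_le_right _ _).trans (by linarith)

theorem cut_lip (R : ℝ) (x y : l2Z) : |cut R x - cut R y| ≤ ‖x - y‖ := by
  have h := abs_norm_sub_norm_le x y
  unfold cut
  rw [abs_le] at *
  grind

def FR (R : ℝ) (x : l2Z) : l2Z := cut R x • F x

theorem FR_norm {R : ℝ} (hR : 0 ≤ R) (x : l2Z) : ‖FR R x‖ ≤ (6 * (R+1)^2 + 4) * (R+1) := by
  unfold FR
  rw [norm_smul, Real.norm_of_nonneg (cut_nonneg _ _)]
  rcases le_total (R + 1) ‖x‖ with h | h
  · rw [cut_out h, zero_mul]; positivity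
  · calc cut R x * ‖F x‖ ≤ 1 * ((6 * (R+1)^2 + 4) * (R+1)) :=
          mul_le_mul (cut_le _ _) (F_norm h) (norm_nonneg _) zero_le_one
      _ = _ := one_mul _

theorem FR_lip_aux {R : ℝ} (hR : 0 ≤ R) {x y : l2Z} (hy : ‖y‖ ≤ R + 1) :
    ‖FR R x - FR R y‖ ≤ (6 * (R+1)^2 + 4) * (R + 2) * ‖x - y‖ := by
  have hM := F_norm hy
  have hc := cut_lip R x y
  have e : FR R x - FR R y = cut R x • (F x - F y) + (cut R x - cut R y) • F y := by
    unfold FR; module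
  have h2 : ‖(cut R x - cut R y) • F y‖ ≤ ‖x - y‖ * ((6 * (R+1)^2 + 4) * (R+1)) := by
    rw [norm_smul, Real.norm_eq_abs]
    gcongr
  have h1 : ‖cut R x • (F x - F y)‖ ≤ (6 * (R+1)^2 + 4) * ‖x - y‖ := by
    rw [norm_smul, Real.norm_of_nonneg (cut_nonneg _ _)]
    rcases le_total (R + 1) ‖x‖ with h | h
    · rw [cut_out h, zero_mul]; positivity
    · calc _ ≤ 1 * _ := mul_le_mul (cut_le _ _) (F_lip h hy) (norm_nonneg _) zero_le_one
        _ = _ := one_mul _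
  rw [e]
  refine (norm_add_le _ _).trans ?_
  linarith

theorem FR_lip {R : ℝ} (hR : 0 ≤ R) :
    LipschitzWith (Real.toNNReal ((6 * (R+1)^2 + 4) * (R + 2))) (FR R) := by
  apply LipschitzWith.of_dist_le_mul
  intro x y
  rw [dist_eq_norm, dist_eq_norm, Real.coe_toNNReal _ (by positivity)]
  rcases le_total ‖y‖ (R + 1) with h | h
  · exact FR_lip_aux hR h
  rcases le_total ‖x‖ (R + 1) with h' | h'
  · rw [norm_sub_rev, norm_sub_rev x y]
    exact FR_lip_aux hR h'
  · simp only [FR, cut_out h, cut_out h', zero_smul, sub_zero, norm_zero]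
    positivity

theorem global_exist {E : Type*} [NormedAddCommGroup E] [NormedSpace ℝ E] [CompleteSpace E]
    (f : E → E) (K L : NNReal) (hK : LipschitzWith K f) (hL : ∀ x, ‖f x‖ ≤ L) (x₀ : E) :
    ∃ α : ℝ → E, α 0 = x₀ ∧ ∀ t, HasDerivAt α (f (α t)) t := by
  have loc : ∀ N : ℕ, ∃ α : ℝ → E, α 0 = x₀ ∧
      ∀ t ∈ Set.Ioo (-(N:ℝ)-1) (N+1), HasDerivAt α (f (α t)) t := by
    intro N
    have h0 : (0:ℝ) ∈ Set.Icc (-(N:ℝ)-1) (N+1) := by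
      constructor <;> linarith [(Nat.cast_nonneg N : (0:ℝ) ≤ N)]
    have hp : IsPicardLindelof (fun _ => f) (⟨0, h0⟩ : Set.Icc (-(N:ℝ)-1) (N+1)) x₀
        (L * (N + 1)) 0 L K := by
      apply IsPicardLindelof.of_time_independent
      · exact fun x _ => hL x
      · exact hK.lipschitzOnWith
      · simp
        rw [add_comm (1:ℝ), max_self]
    obtain ⟨α, h1, h2⟩ := hp.exists_eq_forall_mem_Icc_hasDerivWithinAt₀
    refine ⟨α, h1, fun t ht => (h2 t (Set.Ioo_subset_Icc_self ht)).hasDerivAt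
      (Icc_mem_nhds ht.1 ht.2)⟩
  choose A hA0 hA using loc
  have cmp : ∀ M N : ℕ, M ≤ N → Set.EqOn (A M) (A N) (Set.Ioo (-(M:ℝ)-1) (M+1)) := by
    intro M N hMN
    have hc : (M:ℝ) ≤ N := by exact_mod_cast hMN
    have hM : (0:ℝ) ≤ M := Nat.cast_nonneg M
    refine ODE_solution_unique_of_mem_Ioo (v := fun _ => f) (s := fun _ => Set.univ) (K := K)
      (t₀ := 0) (fun _ _ => hK.lipschitzOnWith) ⟨by linarith, by linarith⟩
      (fun t ht => ⟨hA M t ht, trivial⟩) (fun t ht => ⟨hA N t ⟨?_, ?_⟩, trivial⟩) ?_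
    · linarith [ht.1]
    · linarith [ht.2]
    · rw [hA0, hA0]
  have cmp' : ∀ M N : ℕ, ∀ t : ℝ, |t| < M + 1 → |t| < N + 1 → A M t = A N t := by
    intro M N t h1 h2
    rw [abs_lt] at h1 h2
    rcases le_total M N with h | h
    · exact cmp M N h ⟨by linarith [h1.1], h1.2⟩
    · exact (cmp N M h ⟨by linarith [h2.1], h2.2⟩).symm
  refine ⟨fun t => A ⌈|t|⌉₊ t, hA0 _, fun t => ?_⟩
  have hlt : ∀ s : ℝ, |s| < (⌈|s|⌉₊ : ℝ) + 1 := fun s => by linarith [Nat.le_ceil |s|]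
  have ht := hlt t
  have ht' := abs_lt.mp ht
  refine (hA ⌈|t|⌉₊ t ⟨by linarith [ht'.1], ht'.2⟩).congr_of_eventuallyEq ?_
  have : ∀ᶠ s in 𝓝 t, |s| < (⌈|t|⌉₊ : ℝ) + 1 :=
    continuous_abs.continuousAt.eventually_lt continuousAt_const ht
  filter_upwards [this] with s hs
  exact cmp' _ _ s (hlt s) hs

theorem log_nonneg' (x : l2Z) (n : ℤ) : 0 ≤ Real.log (1 + Complex.normSq (x n)) :=
  Real.log_nonneg (by linarith [Complex.normSq_nonneg (x n)])

theorem log_summable (x : l2Z) : Summable (fun n : ℤ => Real.log (1 + Complex.normSq (x n))) := by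
  refine Summable.of_nonneg_of_le (log_nonneg' x) (fun n => ?_) (l2_summable x)
  rw [← Complex.normSq_eq_norm_sq]
  have := Real.log_le_sub_one_of_pos (x := 1 + Complex.normSq (x n))
    (by linarith [Complex.normSq_nonneg (x n)])
  linarith

def Lsum (x : l2Z) : ℝ := ∑' n : ℤ, Real.log (1 + Complex.normSq (x n))

theorem Lsum_nonneg (x : l2Z) : 0 ≤ Lsum x := tsum_nonneg (log_nonneg' x)

theorem norm_le_Lsum (x : l2Z) : ‖x‖ ^ 2 ≤ Real.exp (Lsum x) * Lsum x := by
  rw [l2_norm_sq]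
  have hs := (log_summable x).mul_left (Real.exp (Lsum x))
  have e : Real.exp (Lsum x) * Lsum x
      = ∑' n : ℤ, Real.exp (Lsum x) * Real.log (1 + Complex.normSq (x n)) := by
    rw [tsum_mul_left]; rfl
  rw [e]
  refine (l2_summable x).tsum_le_tsum (fun n => ?_) hs
  rw [← Complex.normSq_eq_norm_sq]
  set u := Complex.normSq (x n) with hu
  have hu0 : 0 ≤ u := Complex.normSq_nonneg _
  have h1 : Real.log (1 + u) ≤ Lsum x :=
    (log_summable x).le_tsum n (fun m _ => log_nonneg' x m)
  have h2 : 1 + u ≤ Real.exp (Lsum x) := by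
    rw [← Real.exp_log (show 0 < 1 + u by linarith)]
    exact Real.exp_le_exp.mpr h1
  have h3 := Real.one_sub_inv_le_log_of_pos (show 0 < 1 + u by linarith)
  have h4 : 0 ≤ Real.log (1 + u) := log_nonneg' x n
  have h5 : u = (1 + u) * (1 - (1 + u)⁻¹) := by
    field_simp
    ring
  calc u = (1 + u) * (1 - (1 + u)⁻¹) := h5
    _ ≤ (1 + u) * Real.log (1 + u) := by gcongr
    _ ≤ _ := by gcongr

def J (x : l2Z) (n : ℤ) : ℝ := -2 * (star (x n) * x (n+1)).im

theorem J_le (x : l2Z) (n : ℤ) : ‖J x n‖ ≤ ‖x n‖ ^ 2 + ‖x (n+1)‖ ^ 2 := by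
  have h := Complex.abs_im_le_norm (star (x n) * x (n+1))
  rw [norm_mul, norm_star] at h
  unfold J
  rw [Real.norm_eq_abs, abs_mul, abs_neg, abs_two]
  nlinarith [sq_nonneg (‖x n‖ - ‖x (n+1)‖)]

theorem J_summable (x : l2Z) : Summable (J x) :=
  Summable.of_norm_bounded ((l2_summable x).add (sum_shift x 1)) (J_le x)

theorem J_diff_hasSum (x : l2Z) : HasSum (fun n => J x n - J x (n-1)) 0 := by
  have h1 := (J_summable x).hasSum
  have h2 : HasSum (fun n => J x (n - 1)) (∑' n, J x n) :=
    (Equiv.subRight (1:ℤ)).hasSum_iff.mpr h1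
  simpa using h1.sub h2

theorem log_deriv {z : ℝ → ℂ} {d : ℂ} {t : ℝ} (h : HasDerivAt z d t) :
    HasDerivAt (fun s => Real.log (1 + Complex.normSq (z s)))
      (2 * ((z t).re * d.re + (z t).im * d.im) / (1 + Complex.normSq (z t))) t := by
  have hr : HasDerivAt (fun s => (z s).re) d.re t :=
    Complex.reCLM.hasFDerivAt.comp_hasDerivAt t h
  have hi : HasDerivAt (fun s => (z s).im) d.im t :=
    Complex.imCLM.hasFDerivAt.comp_hasDerivAt t h
  have hn : HasDerivAt (fun s => 1 + Complex.normSq (z s))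
      (2 * ((z t).re * d.re + (z t).im * d.im)) t := by
    have := ((hr.mul hr).add (hi.mul hi)).const_add 1
    simp only [Complex.normSq_apply]
    refine this.congr_deriv ?_
    ring
  exact hn.log (by have := Complex.normSq_nonneg (z t); positivity)

theorem conserve (α : ℝ → l2Z) (φ : ℝ → ℝ) (hα : Continuous α) (hφ : Continuous φ)
    (h : ∀ t n, HasDerivAt (fun s => α s n) ((φ t : ℂ) * Fc (α t) n) t) (t : ℝ) :
    Lsum (α t) = Lsum (α 0) := by
  have hd : ∀ n s, HasDerivAt (fun s => Real.log (1 + Complex.normSq (α s n)))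
      (φ s * (J (α s) n - J (α s) (n-1))) s := by
    intro n s
    convert log_deriv (h s n) using 1
    have h0 : 1 + Complex.normSq (α s n) ≠ 0 := by
      have := Complex.normSq_nonneg (α s n); positivity
    rw [eq_div_iff h0]
    simp [J, Fc, Complex.normSq_apply]
    ring
  have hc : ∀ n, Continuous (fun s => α s n) := fun n =>
    (lp.evalCLM ℝ (fun _ : ℤ => ℂ) 2 n).continuous.comp hα
  have hJ : ∀ n, Continuous (fun s => J (α s) n) := by
    intro n
    have h1 := hc n
    have h2 := hc (n+1)
    exact continuous_const.mul (Complex.continuous_im.comp (h1.star.mul h2))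
  have hint : ∀ n, Continuous (fun s => φ s * (J (α s) n - J (α s) (n-1))) :=
    fun n => hφ.mul ((hJ n).sub (hJ (n-1)))
  have hi : ∀ n, ∫ s in (0:ℝ)..t, φ s * (J (α s) n - J (α s) (n-1))
      = Real.log (1 + Complex.normSq (α t n)) - Real.log (1 + Complex.normSq (α 0 n)) := by
    intro n
    exact intervalIntegral.integral_eq_sub_of_hasDerivAt (fun s _ => hd n s)
      ((hint n).intervalIntegrable _ _)
  have hb : ∀ s, HasSum (fun n => |φ s| * ((‖α s n‖^2 + ‖α s (n+1)‖^2)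
      + (‖α s (n + -1)‖^2 + ‖α s n‖^2))) (|φ s| * ((‖α s‖^2 + ‖α s‖^2) + (‖α s‖^2 + ‖α s‖^2))) := by
    intro s
    have h0 : HasSum (fun n => ‖α s n‖^2) (‖α s‖^2) := by
      rw [l2_norm_sq]; exact (l2_summable _).hasSum
    have h1 : ∀ k, HasSum (fun n => ‖α s (n+k)‖^2) (‖α s‖^2) := by
      intro k; rw [← tsum_shift _ k]; exact (sum_shift _ k).hasSum
    exact ((h0.add (h1 1)).add ((h1 (-1)).add h0)).mul_left _
  have key := intervalIntegral.hasSum_integral_of_dominated_convergence (μ := volume)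
    (a := 0) (b := t) (F := fun (n : ℤ) s => φ s * (J (α s) n - J (α s) (n-1))) (f := fun _ => 0)
    (fun n s => |φ s| * ((‖α s n‖^2 + ‖α s (n+1)‖^2) + (‖α s (n + -1)‖^2 + ‖α s n‖^2)))
    (fun n => (hint n).aestronglyMeasurable)
    (fun n => Eventually.of_forall fun s _ => by
      rw [norm_mul, Real.norm_eq_abs]
      have h1 := J_le (α s) n
      have h2 := J_le (α s) (n-1)
      rw [sub_add_cancel] at h2
      have h3 := norm_sub_le (J (α s) n) (J (α s) (n-1))
      rw [← sub_eq_add_neg]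
      gcongr
      linarith)
    (Eventually.of_forall fun s _ => (hb s).summable)
    (by
      simp_rw [fun s => (hb s).tsum_eq]
      apply Continuous.intervalIntegrable
      fun_prop)
    (Eventually.of_forall fun s _ => by
      simpa using (J_diff_hasSum (α s)).mul_left (φ s))
  simp only [hi, intervalIntegral.integral_zero] at key
  have h2 := ((log_summable (α t)).hasSum.sub (log_summable (α 0)).hasSum).unique key
  exact sub_eq_zero.mp h2

theorem bound_of_conserve {x a : l2Z} (h : Lsum x = Lsum a) :
    ‖x‖ ≤ Real.exp (Lsum a) * Lsum a + 1 := by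
  have h1 := norm_le_Lsum x
  rw [h] at h1
  have h0 : 0 ≤ Real.exp (Lsum a) * Lsum a := mul_nonneg (Real.exp_pos _).le (Lsum_nonneg a)
  nlinarith [norm_nonneg x]

theorem coord_deriv {α : ℝ → l2Z} {d : l2Z} {t : ℝ} (h : HasDerivAt α d t) (n : ℤ) :
    HasDerivAt (fun s => α s n) (d n) t :=
  (lp.evalCLM ℝ (fun _ : ℤ => ℂ) 2 n).hasFDerivAt.comp_hasDerivAt t h

theorem eq_iff_Fc (x : l2Z) (n : ℤ) (d : ℂ) :
    Complex.I * d = -(1 + (Complex.normSq (x n) : ℂ)) * (x (n+1) + x (n-1)) + 2 * x n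
      ↔ d = Fc x n := by
  unfold Fc
  constructor
  · intro h
    linear_combination (-Complex.I) * h + d * Complex.I_mul_I
  · intro h
    rw [h]
    linear_combination ((1 + (Complex.normSq (x n) : ℂ)) * (x (n+1) + x (n-1)) - 2 * x n)
      * Complex.I_mul_I

theorem sol_deriv {α : ℝ → l2Z} (h1 : ContDiff ℝ 1 α) (h : ALl2Equation α) (t : ℝ) :
    HasDerivAt α (F (α t)) t := by
  have hd : HasDerivAt α (deriv α t) t := (h1.differentiable one_ne_zero t).hasDerivAt
  have e : deriv α t = F (α t) := by
    ext n
    obtain ⟨d, hd', he⟩ := h n t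
    rw [(coord_deriv hd n).unique hd', (eq_iff_Fc _ _ _).mp he]
    rfl
  rwa [e] at hd

theorem sol_conserve {α : ℝ → l2Z} (h : ∀ t, HasDerivAt α (F (α t)) t) (t : ℝ) :
    Lsum (α t) = Lsum (α 0) := by
  refine conserve α (fun _ => 1) ?_ continuous_const (fun t n => ?_) t
  · exact continuous_iff_continuousAt.mpr fun t => (h t).continuousAt
  · simpa [F_apply] using coord_deriv (h t) n


/-- for every a ∈ ℓ²(ℤ,ℂ) there exists a unique C¹ curve α : ℝ → ℓ²(ℤ,ℂ) with
α(0) = a solving the Ablowitz–Ladik system; moreover, for this solution the quantity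
Σ_n 2 log(1+|α_n(t)|²) is finite and independent of t. -/
theorem ablowitz_ladik_l2_wellposed (a : l2Z) :
    (∃! α : ℝ → l2Z, ContDiff ℝ 1 α ∧ α 0 = a ∧ ALl2Equation α) ∧
    (∀ α : ℝ → l2Z, ContDiff ℝ 1 α → α 0 = a → ALl2Equation α →
      ∀ t : ℝ,
        Summable (fun n : ℤ => 2 * Real.log (1 + Complex.normSq (α t n))) ∧
        (∑' n : ℤ, 2 * Real.log (1 + Complex.normSq (α t n)))
          = ∑' n : ℤ, 2 * Real.log (1 + Complex.normSq (a n))) := by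
  set R : ℝ := Real.exp (Lsum a) * Lsum a + 1 with hRdef
  have hR : 0 ≤ R := by
    have := mul_nonneg (Real.exp_pos (Lsum a)).le (Lsum_nonneg a)
    linarith
  refine ⟨?_, ?_⟩
  · obtain ⟨α, h0, hα⟩ := global_exist (FR R) _
      (Real.toNNReal ((6 * (R+1)^2 + 4) * (R+1))) (FR_lip hR)
      (fun x => by rw [Real.coe_toNNReal _ (by positivity)]; exact FR_norm hR x) a
    have hcont : Continuous α := continuous_iff_continuousAt.mpr fun t => (hα t).continuousAt
    have hcons : ∀ t, Lsum (α t) = Lsum (α 0) :=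
      conserve α (fun t => cut R (α t)) hcont ((cut_cont R).comp hcont)
        (fun t n => by simpa [FR, F_apply] using coord_deriv (hα t) n)
    have hFR : ∀ {x : l2Z}, ‖x‖ ≤ R → FR R x = F x := fun hx => by
      rw [FR, cut_one hx, one_smul]
    have hα' : ∀ t, HasDerivAt α (F (α t)) t := fun t => by
      have := hα t
      rwa [hFR (bound_of_conserve (by rw [hcons t, h0]))] at this
    refine ⟨α, ⟨?_, h0, ?_⟩, ?_⟩
    · rw [contDiff_one_iff_deriv]
      refine ⟨fun t => (hα' t).differentiableAt, ?_⟩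
      rw [show deriv α = fun t => F (α t) from funext fun t => (hα' t).deriv]
      exact F_cont.comp hcont
    · intro n t
      exact ⟨F (α t) n, coord_deriv (hα' t) n, (eq_iff_Fc _ _ _).mpr rfl⟩
    · rintro β ⟨hβ1, hβ0, hβe⟩
      have hβ := sol_deriv hβ1 hβe
      refine ODE_solution_unique_univ (v := fun _ => FR R) (s := fun _ => Set.univ) (t₀ := 0)
        (fun _ => (FR_lip hR).lipschitzOnWith) (fun t => ⟨?_, trivial⟩)
        (fun t => ⟨hα t, trivial⟩) (by rw [hβ0, h0])
      rw [hFR (bound_of_conserve (by rw [sol_conserve hβ t, hβ0]))]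
      exact hβ t
  · intro α h1 h0 he t
    refine ⟨(log_summable (α t)).mul_left 2, ?_⟩
    rw [tsum_mul_left, tsum_mul_left]
    have := sol_conserve (sol_deriv h1 he) t
    rw [h0] at this
    unfold Lsum at this
    rw [this]
end
end

section
/- Call F : ℂ^ℤ → ℝ a smooth cylinder function if it depends only on the coordinates α_n with n in some finite set and is smooth in those coordinates; write x_n = Re α_n, y_n = Im α_n. Define two brackets on smooth cylinder functions: {F,G}₀(α) = Σ_{n∈ℤ} (1+|α_n|²)( (∂F/∂x_n)(∂G/∂y_n) − (∂F/∂y_n)(∂G/∂x_n) ), and {F,G}(α) = Σ_{n,m∈ℤ} Σ_{u,v∈{x,y}} c^{uv}_{nm}(α) (∂F/∂u_n)(∂G/∂v_m), where the structure coefficients are c^{xy}_{nm} = {Re α_n, Im α_m}, c^{xx}_{nm} = {Re α_n, Re α_m}, c^{yy}_{nm} = {Im α_n, Im α_m}, c^{yx}_{nm} = −c^{xy}_{mn}, as given by the table in the context (both sums have only finitely many nonzero terms for cylinder functions). Then the two brackets are compatible: for all smooth cylinder functions F, G, H, {F,{G,H}₀} + {G,{H,F}₀} + {H,{F,G}₀}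 + {F,{G,H}}₀ + {G,{H,F}}₀ + {H,{F,G}}₀ = 0. -/
open scoped BigOperators
noncomputable section

/-- A smooth cylinder function on ℂ^ℤ: it depends only on the coordinates α_n with n in some
finite set, and is smooth in those coordinates. -/
def SmoothCylinder (F : (ℤ → ℂ) → ℝ) : Prop :=
  ∃ (E : Finset ℤ) (g : ({x // x ∈ E} → ℂ) → ℝ),
    ContDiff ℝ (⊤ : ℕ∞) g ∧ ∀ a : ℤ → ℂ, F a = g (fun n => a n.val)

/-- The partial derivative ∂F/∂x_n, where x_n = Re α_n. -/
def dx (n : ℤ) (F : (ℤ → ℂ) → ℝ) (a : ℤ → ℂ) : ℝ :=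
  deriv (fun s : ℝ => F (Function.update a n (a n + s))) 0

/-- The partial derivative ∂F/∂y_n, where y_n = Im α_n. -/
def dy (n : ℤ) (F : (ℤ → ℂ) → ℝ) (a : ℤ → ℂ) : ℝ :=
  deriv (fun s : ℝ => F (Function.update a n (a n + s * Complex.I))) 0

/-- The structure coefficient c^{xy}_{nm}(α) = {Re α_n, Im α_m}. -/
def cxy (a : ℤ → ℂ) (n m : ℤ) : ℝ :=
  if m + 2 ≤ n then
    -((1 + Complex.normSq (a m))/2) * (a n).im * (a (m-1) - a (m+1)).im
  else if n = m + 1 then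
    -((1 + Complex.normSq (a m))/2)
      * ((a n).im * (a (m-1) - a (m+1)).im + (1 + Complex.normSq (a n))/2)
  else if n = m then
    ((1 + Complex.normSq (a n))/2) * (1 - (a n * (starRingEnd ℂ) (a (n-1))).re)
  else if n = m - 1 then
    -((1 + Complex.normSq (a n))/2)
      * ((a m).re * (a (n-1) - a (n+1)).re + (1 + Complex.normSq (a m))/2)
  else
    -((1 + Complex.normSq (a n))/2) * (a m).re * (a (n-1) - a (n+1)).re

/-- The structure coefficient c^{xx}_{nm}(α) = {Re α_n, Re α_m} (extended by antisymmetry). -/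
def cxx (a : ℤ → ℂ) (n m : ℤ) : ℝ :=
  if m + 1 ≤ n then
    -((1 + Complex.normSq (a m))/2) * (a n).im * (a (m-1) - a (m+1)).re
  else if n = m then 0
  else ((1 + Complex.normSq (a n))/2) * (a m).im * (a (n-1) - a (n+1)).re

/-- The structure coefficient c^{yy}_{nm}(α) = {Im α_n, Im α_m} (extended by antisymmetry). -/
def cyy (a : ℤ → ℂ) (n m : ℤ) : ℝ :=
  if m + 1 ≤ n then
    ((1 + Complex.normSq (a m))/2) * (a n).re * (a (m-1) - a (m+1)).im
  else if n = m then 0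
  else -((1 + Complex.normSq (a n))/2) * (a m).re * (a (n-1) - a (n+1)).im

/-- The bracket {F,G}(α) = Σ_{n,m} Σ_{u,v∈{x,y}} c^{uv}_{nm}(α) (∂F/∂u_n)(∂G/∂v_m),
with c^{yx}_{nm} = −c^{xy}_{mn}. -/
def pbAL (F G : (ℤ → ℂ) → ℝ) (a : ℤ → ℂ) : ℝ :=
  ∑' nm : ℤ × ℤ,
    (cxy a nm.1 nm.2 * dx nm.1 F a * dy nm.2 G a
      + cxx a nm.1 nm.2 * dx nm.1 F a * dx nm.2 G a
      + cyy a nm.1 nm.2 * dy nm.1 F a * dy nm.2 G a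
      - cxy a nm.2 nm.1 * dy nm.1 F a * dx nm.2 G a)

/-- The bracket {F,G}₀(α) = Σ_n (1+|α_n|²)((∂F/∂x_n)(∂G/∂y_n) − (∂F/∂y_n)(∂G/∂x_n)). -/
def pbAL0 (F G : (ℤ → ℂ) → ℝ) (a : ℤ → ℂ) : ℝ :=
  ∑' n : ℤ, (1 + Complex.normSq (a n)) * (dx n F a * dy n G a - dy n F a * dx n G a)

namespace ALC

/-- coordinate -/
def X (a : ℤ → ℂ) (n : ℤ) (u : Bool) : ℝ := match u with
  | false => (a n).re
  | true => (a n).im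

def ev (n : ℤ) (u : Bool) : ℤ → ℂ := Pi.single n (match u with
  | false => 1
  | true => Complex.I)

def DD (l : ℤ × Bool) (F : (ℤ → ℂ) → ℝ) (a : ℤ → ℂ) : ℝ := lineDeriv ℝ F a (ev l.1 l.2)

def dl (n : ℤ) (u : Bool) (m : ℤ) (v : Bool) : ℝ := if n = m ∧ u = v then 1 else 0

def sg : Bool → Bool → ℝ
  | false, true => 1
  | true, false => -1
  | _, _ => 0

def sr : Bool → ℝ
  | false => -1
  | true => 1

def rho (a : ℤ → ℂ) (n : ℤ) : ℝ := 1 + X a n false ^ 2 + X a n true ^ 2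

def drho (a : ℤ → ℂ) (p : ℤ) (s : Bool) (n : ℤ) : ℝ :=
  2 * X a n false * dl p s n false + 2 * X a n true * dl p s n true

def gt (a : ℤ → ℂ) (n : ℤ) (u : Bool) (m : ℤ) (v : Bool) : ℝ :=
  sr u * X a n (!u) * (rho a m / 2) * (X a (m-1) v - X a (m+1) v)
    - (if n = m + 1 then sg u v * rho a n * rho a m / 4 else 0)

def dgt (a : ℤ → ℂ) (p : ℤ) (s : Bool) (n : ℤ) (u : Bool) (m : ℤ) (v : Bool) : ℝ :=
  sr u * dl p s n (!u) * (rho a m / 2) * (X a (m-1) v - X a (m+1) v)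
  + sr u * X a n (!u) * (drho a p s m / 2) * (X a (m-1) v - X a (m+1) v)
  + sr u * X a n (!u) * (rho a m / 2) * (dl p s (m-1) v - dl p s (m+1) v)
    - (if n = m + 1 then sg u v * (drho a p s n * rho a m + rho a n * drho a p s m) / 4 else 0)

def loc (a : ℤ → ℂ) (n : ℤ) (u v : Bool) : ℝ :=
  sg u v * (rho a n / 2) * (1 - X a n false * X a (n-1) false - X a n true * X a (n-1) true)

def dloc (a : ℤ → ℂ) (p : ℤ) (s : Bool) (n : ℤ) (u v : Bool) : ℝ :=
  sg u v * (drho a p s n / 2) *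
    (1 - X a n false * X a (n-1) false - X a n true * X a (n-1) true)
  - sg u v * (rho a n / 2) * (dl p s n false * X a (n-1) false + X a n false * dl p s (n-1) false
      + dl p s n true * X a (n-1) true + X a n true * dl p s (n-1) true)

def P (a : ℤ → ℂ) (i j : ℤ × Bool) : ℝ :=
  if i.1 = j.1 then loc a i.1 i.2 j.2
  else if j.1 < i.1 then gt a i.1 i.2 j.1 j.2
  else - gt a j.1 j.2 i.1 i.2

def dP (a : ℤ → ℂ) (l i j : ℤ × Bool) : ℝ :=
  if i.1 = j.1 then dloc a l.1 l.2 i.1 i.2 j.2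
  else if j.1 < i.1 then dgt a l.1 l.2 i.1 i.2 j.1 j.2
  else - dgt a l.1 l.2 j.1 j.2 i.1 i.2

def Q (a : ℤ → ℂ) (i j : ℤ × Bool) : ℝ :=
  if i.1 = j.1 then sg i.2 j.2 * rho a i.1 else 0

def dQ (a : ℤ → ℂ) (l i j : ℤ × Bool) : ℝ :=
  if i.1 = j.1 then sg i.2 j.2 * drho a l.1 l.2 i.1 else 0

lemma sg_anti (u v : Bool) : sg u v = - sg v u := by cases u <;> cases v <;> simp [sg]

lemma P_anti (a) (i j) : P a i j = - P a j i := by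
  unfold P
  rcases lt_trichotomy i.1 j.1 with h | h | h
  · rw [if_neg h.ne, if_neg h.not_gt, if_neg h.ne', if_pos h]
  · rw [if_pos h, if_pos h.symm, h]; unfold loc; rw [sg_anti]; ring
  · rw [if_neg h.ne', if_pos h, if_neg h.ne, if_neg h.not_gt]; ring

lemma dP_anti (a) (l i j) : dP a l i j = - dP a l j i := by
  unfold dP
  rcases lt_trichotomy i.1 j.1 with h | h | h
  · rw [if_neg h.ne, if_neg h.not_gt, if_neg h.ne', if_pos h]
  · rw [if_pos h, if_pos h.symm, h]; unfold dloc; rw [sg_anti]; ring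
  · rw [if_neg h.ne', if_pos h, if_neg h.ne, if_neg h.not_gt]; ring

lemma Q_anti (a) (i j) : Q a i j = - Q a j i := by
  unfold Q
  by_cases h : i.1 = j.1
  · rw [if_pos h, if_pos h.symm, h, sg_anti]; ring
  · rw [if_neg h, if_neg (Ne.symm h)]; simp

/-- closed forms -/
def pd (a : ℤ → ℂ) (i j k : ℤ × Bool) : ℝ :=
  if j.1 = k.1 then sg j.2 k.2 *
    (P a i (j.1, false) * (2 * X a j.1 false) + P a i (j.1, true) * (2 * X a j.1 true)) else 0

def qd (a : ℤ → ℂ) (i j k : ℤ × Bool) : ℝ :=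
  sg i.2 (!i.2) * rho a i.1 * dP a (i.1, !i.2) j k

def J (a : ℤ → ℂ) (i j k : ℤ × Bool) : ℝ :=
  pd a i j k + pd a j k i + pd a k i j + qd a i j k + qd a j k i + qd a k i j

lemma pd_anti (a i j k) : pd a i j k = - pd a i k j := by
  unfold pd
  by_cases h : j.1 = k.1
  · rw [if_pos h, if_pos h.symm, h, sg_anti]; ring
  · rw [if_neg h, if_neg (Ne.symm h)]; simp

lemma J_anti (a i j k) : J a i j k = - J a i k j := by
  unfold J
  rw [pd_anti a i j k, pd_anti a j k i, pd_anti a k i j]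
  unfold qd
  rw [dP_anti a _ j k, dP_anti a _ k i, dP_anti a _ i j]; ring

lemma J_cyc (a i j k) : J a i j k = J a j k i := by
  unfold J; ring

lemma dl_same (n u) : dl n u n u = 1 := by simp [dl]
lemma dl_ne (n u m v) (h : n ≠ m) : dl n u m v = 0 := by simp [dl, h]
lemma dl_ft (n m) : dl n false m true = 0 := by simp [dl]
lemma dl_tf (n m) : dl n true m false = 0 := by simp [dl]

lemma P_eq (a) (n : ℤ) (u v) : P a (n,u) (n,v) = loc a n u v := by simp [P]
lemma P_gt (a) (n m : ℤ) (u v) (h : m < n) : P a (n,u) (m,v) = gt a n u m v := by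
  simp [P, h, h.ne']
lemma P_lt (a) (n m : ℤ) (u v) (h : n < m) : P a (n,u) (m,v) = - gt a m v n u := by
  simp [P, h.ne, h.not_gt]
lemma dP_eq (a l) (n : ℤ) (u v) : dP a l (n,u) (n,v) = dloc a l.1 l.2 n u v := by simp [dP]
lemma dP_gt (a l) (n m : ℤ) (u v) (h : m < n) :
    dP a l (n,u) (m,v) = dgt a l.1 l.2 n u m v := by
  simp [dP, h, h.ne']
lemma dP_lt (a l) (n m : ℤ) (u v) (h : n < m) :
    dP a l (n,u) (m,v) = - dgt a l.1 l.2 m v n u := by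
  simp [dP, h.ne, h.not_gt]
lemma pd_eq (a i) (m : ℤ) (u v) : pd a i (m,u) (m,v) = sg u v *
    (P a i (m, false) * (2 * X a m false) + P a i (m, true) * (2 * X a m true)) := by simp [pd]
lemma pd_ne (a i) (m k : ℤ) (u v) (h : m ≠ k) : pd a i (m,u) (k,v) = 0 := by simp [pd, h]
lemma gt_one (a) (m : ℤ) (u v) : gt a (m+1) u m v =
  sr u * X a (m+1) (!u) * (rho a m / 2) * (X a (m-1) v - X a (m+1) v)
    - sg u v * rho a (m+1) * rho a m / 4 := by simp [gt]
lemma gt_two (a) (n m : ℤ) (u v) (h : n ≠ m + 1) : gt a n u m v =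
  sr u * X a n (!u) * (rho a m / 2) * (X a (m-1) v - X a (m+1) v) := by simp [gt, h]
lemma dgt_one (a p s) (m : ℤ) (u v) : dgt a p s (m+1) u m v =
  sr u * dl p s (m+1) (!u) * (rho a m / 2) * (X a (m-1) v - X a (m+1) v)
  + sr u * X a (m+1) (!u) * (drho a p s m / 2) * (X a (m-1) v - X a (m+1) v)
  + sr u * X a (m+1) (!u) * (rho a m / 2) * (dl p s (m-1) v - dl p s (m+1) v)
    - sg u v * (drho a p s (m+1) * rho a m + rho a (m+1) * drho a p s m) / 4 := by simp [dgt]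
lemma dgt_two (a p s) (n m : ℤ) (u v) (h : n ≠ m + 1) : dgt a p s n u m v =
  sr u * dl p s n (!u) * (rho a m / 2) * (X a (m-1) v - X a (m+1) v)
  + sr u * X a n (!u) * (drho a p s m / 2) * (X a (m-1) v - X a (m+1) v)
  + sr u * X a n (!u) * (rho a m / 2) * (dl p s (m-1) v - dl p s (m+1) v) := by simp [dgt, h]

lemma J_sorted (a : ℤ → ℂ) (n m k : ℤ) (u v w : Bool) (h1 : n ≤ m) (h2 : m ≤ k) :
    J a (n,u) (m,v) (k,w) = 0 := by
  have c1 : m = n ∨ m = n + 1 ∨ n + 2 ≤ m := by omega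
  have c2 : k = m ∨ k = m + 1 ∨ m + 2 ≤ k := by omega
  rcases c1 with rfl | rfl | h1 <;> rcases c2 with rfl | rfl | h2 <;>
  cases u <;> cases v <;> cases w <;>
  · simp (disch := omega) only [J, qd, pd_eq, pd_ne, P_eq, P_gt, P_lt, dP_eq, dP_gt, dP_lt,
      gt_one, gt_two, dgt_one, dgt_two, loc, dloc, drho, Bool.not_true, Bool.not_false,
      dl_same, dl_ft, dl_tf, dl_ne, sg, sr, add_sub_cancel_right]
    try unfold rho
    ring

lemma J_zero (a : ℤ → ℂ) (i j k : ℤ × Bool) : J a i j k = 0 := by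
  have key : ∀ i j k : ℤ × Bool, i.1 ≤ j.1 → j.1 ≤ k.1 → J a i j k = 0 := by
    rintro ⟨n, u⟩ ⟨m, v⟩ ⟨k, w⟩ h1 h2
    exact J_sorted a n m k u v w h1 h2
  rcases le_total i.1 j.1 with h1 | h1 <;> rcases le_total j.1 k.1 with h2 | h2 <;>
    rcases le_total i.1 k.1 with h3 | h3
  · exact key _ _ _ h1 h2
  · exact key _ _ _ h1 h2
  · rw [J_anti, key _ _ _ h3 h2, neg_zero]
  · rw [J_cyc, J_cyc, key _ _ _ h3 h1]
  · rw [J_cyc, J_anti, key _ _ _ h1 h3, neg_zero]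
  · rw [J_cyc, key _ _ _ h2 h3]
  · rw [J_cyc, J_cyc, J_anti, key _ _ _ h2 h1, neg_zero]
  · rw [J_cyc, J_cyc, J_anti, key _ _ _ h2 h1, neg_zero]

section abs
variable {ι : Type*} (S : Finset ι)

def T (p q : ι → ι → ℝ) (dq : ι → ι → ι → ℝ) (f g h : ι → ℝ) (g2 h2 : ι → ι → ℝ) : ℝ :=
  ∑ i ∈ S, ∑ l ∈ S, p i l * f i * (∑ j ∈ S, ∑ k ∈ S,
    (dq l j k * g j * h k + q j k * g2 l j * h k + q j k * g j * h2 l k))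

def TA (p : ι → ι → ℝ) (dq : ι → ι → ι → ℝ) (f g h : ι → ℝ) : ℝ :=
  ∑ i ∈ S, ∑ j ∈ S, ∑ k ∈ S, (∑ l ∈ S, p i l * dq l j k) * (f i * g j * h k)

def TB (p q : ι → ι → ℝ) (f h : ι → ℝ) (g2 : ι → ι → ℝ) : ℝ :=
  ∑ i ∈ S, ∑ l ∈ S, ∑ j ∈ S, ∑ k ∈ S, p i l * q j k * f i * g2 l j * h k

def TC (p q : ι → ι → ℝ) (f g : ι → ℝ) (h2 : ι → ι → ℝ) : ℝ :=
  ∑ i ∈ S, ∑ l ∈ S, ∑ j ∈ S, ∑ k ∈ S, p i l * q j k * f i * g j * h2 l k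

lemma T_eq (p q dq f g h g2 h2) :
    T S p q dq f g h g2 h2 = TA S p dq f g h + TB S p q f h g2 + TC S p q f g h2 := by
  have hA : TA S p dq f g h = ∑ i ∈ S, ∑ l ∈ S, ∑ j ∈ S, ∑ k ∈ S,
      p i l * f i * (dq l j k * g j * h k) := by
    unfold TA
    refine Finset.sum_congr rfl fun i _ => ?_
    rw [Finset.sum_comm]
    simp only [Finset.sum_mul]
    calc _ = ∑ k ∈ S, ∑ l ∈ S, ∑ j ∈ S, p i l * dq l j k * (f i * g j * h k) :=
          Finset.sum_congr rfl fun k _ => Finset.sum_comm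
      _ = ∑ l ∈ S, ∑ k ∈ S, ∑ j ∈ S, p i l * dq l j k * (f i * g j * h k) := Finset.sum_comm
      _ = ∑ l ∈ S, ∑ j ∈ S, ∑ k ∈ S, p i l * dq l j k * (f i * g j * h k) :=
          Finset.sum_congr rfl fun k _ => Finset.sum_comm
      _ = _ := by
          refine Finset.sum_congr rfl fun l _ => Finset.sum_congr rfl fun j _ =>
            Finset.sum_congr rfl fun k _ => by ring
  rw [hA]
  unfold T TB TC
  simp only [← Finset.sum_add_distrib, Finset.mul_sum]
  refine Finset.sum_congr rfl fun i _ => Finset.sum_congr rfl fun l _ =>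
    Finset.sum_congr rfl fun j _ => Finset.sum_congr rfl fun k _ => by ring

lemma TBC (p q : ι → ι → ℝ) (f h : ι → ℝ) (g2 : ι → ι → ℝ)
    (hq : ∀ i j, q i j = - q j i) (hg : ∀ i j, g2 i j = g2 j i) :
    TC S q p h f g2 = - TB S p q f h g2 := by
  unfold TB TC
  simp only [← Finset.sum_neg_distrib]
  calc _ = ∑ l ∈ S, ∑ i ∈ S, ∑ j ∈ S, ∑ k ∈ S, q i l * p j k * h i * f j * g2 l k :=
        Finset.sum_comm
    _ = ∑ l ∈ S, ∑ j ∈ S, ∑ i ∈ S, ∑ k ∈ S, q i l * p j k * h i * f j * g2 l k :=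
        Finset.sum_congr rfl fun _ _ => Finset.sum_comm
    _ = ∑ j ∈ S, ∑ l ∈ S, ∑ i ∈ S, ∑ k ∈ S, q i l * p j k * h i * f j * g2 l k :=
        Finset.sum_comm
    _ = ∑ j ∈ S, ∑ l ∈ S, ∑ k ∈ S, ∑ i ∈ S, q i l * p j k * h i * f j * g2 l k :=
        Finset.sum_congr rfl fun _ _ => Finset.sum_congr rfl fun _ _ => Finset.sum_comm
    _ = ∑ j ∈ S, ∑ k ∈ S, ∑ l ∈ S, ∑ i ∈ S, q i l * p j k * h i * f j * g2 l k :=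
        Finset.sum_congr rfl fun _ _ => Finset.sum_comm
    _ = _ := by
        refine Finset.sum_congr rfl fun i _ => Finset.sum_congr rfl fun l _ =>
          Finset.sum_congr rfl fun j _ => Finset.sum_congr rfl fun k _ => ?_
        rw [hq k j, hg j l]; ring

lemma TA_rot (p dq f g h) : TA S p dq g h f =
    ∑ i ∈ S, ∑ j ∈ S, ∑ k ∈ S, (∑ l ∈ S, p j l * dq l k i) * (f i * g j * h k) := by
  unfold TA
  calc _ = ∑ j ∈ S, ∑ i ∈ S, ∑ k ∈ S, (∑ l ∈ S, p j l * dq l k i) * (g j * h k * f i) :=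
        Finset.sum_congr rfl fun _ _ => Finset.sum_comm
    _ = ∑ i ∈ S, ∑ j ∈ S, ∑ k ∈ S, (∑ l ∈ S, p j l * dq l k i) * (g j * h k * f i) :=
        Finset.sum_comm
    _ = _ := by
        refine Finset.sum_congr rfl fun i _ => Finset.sum_congr rfl fun l _ =>
          Finset.sum_congr rfl fun j _ => by ring

lemma TA_rot2 (p dq f g h) : TA S p dq h f g =
    ∑ i ∈ S, ∑ j ∈ S, ∑ k ∈ S, (∑ l ∈ S, p k l * dq l i j) * (f i * g j * h k) := by
  unfold TA
  calc _ = ∑ i ∈ S, ∑ k ∈ S, ∑ j ∈ S, (∑ l ∈ S, p k l * dq l i j) * (h k * f i * g j) :=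
        Finset.sum_comm
    _ = ∑ i ∈ S, ∑ j ∈ S, ∑ k ∈ S, (∑ l ∈ S, p k l * dq l i j) * (h k * f i * g j) :=
        Finset.sum_congr rfl fun _ _ => Finset.sum_comm
    _ = _ := by
        refine Finset.sum_congr rfl fun i _ => Finset.sum_congr rfl fun l _ =>
          Finset.sum_congr rfl fun j _ => by ring

lemma abs_main (p q : ι → ι → ℝ) (dp dq : ι → ι → ι → ℝ) (f g h : ι → ℝ) (f2 g2 h2 : ι → ι → ℝ)
    (hp : ∀ i j, p i j = - p j i) (hq : ∀ i j, q i j = - q j i)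
    (hf : ∀ i j, f2 i j = f2 j i) (hg : ∀ i j, g2 i j = g2 j i) (hh : ∀ i j, h2 i j = h2 j i)
    (hJ : ∀ i ∈ S, ∀ j ∈ S, ∀ k ∈ S,
      (∑ l ∈ S, p i l * dq l j k) + (∑ l ∈ S, p j l * dq l k i) + (∑ l ∈ S, p k l * dq l i j)
      + (∑ l ∈ S, q i l * dp l j k) + (∑ l ∈ S, q j l * dp l k i)
      + (∑ l ∈ S, q k l * dp l i j) = 0) :
    T S p q dq f g h g2 h2 + T S p q dq g h f h2 f2 + T S p q dq h f g f2 g2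
    + T S q p dp f g h g2 h2 + T S q p dp g h f h2 f2 + T S q p dp h f g f2 g2 = 0 := by
  have hA : TA S p dq f g h + TA S p dq g h f + TA S p dq h f g
      + TA S q dp f g h + TA S q dp g h f + TA S q dp h f g = 0 := by
    rw [TA_rot S p dq f g h, TA_rot2 S p dq f g h, TA_rot S q dp f g h, TA_rot2 S q dp f g h]
    unfold TA
    simp only [← Finset.sum_add_distrib, ← add_mul]
    refine Finset.sum_eq_zero fun i hi => Finset.sum_eq_zero fun j hj =>
      Finset.sum_eq_zero fun k hk => ?_
    have := hJ i hi j hj k hk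
    simp only [← Finset.sum_add_distrib] at this
    rw [this, zero_mul]
  simp only [T_eq]
  rw [TBC S p q f h g2 hq hg, TBC S q p f h g2 hp hg, TBC S p q g f h2 hq hh,
    TBC S q p g f h2 hp hh, TBC S p q h g f2 hq hf, TBC S q p h g f2 hp hf]
  linarith
end abs

/-- cylinder over a fixed finite set -/
def Cyl (E : Finset ℤ) (F : (ℤ → ℂ) → ℝ) : Prop :=
  ∃ g : ({x // x ∈ E} → ℂ) → ℝ,
    ContDiff ℝ (⊤ : ℕ∞) g ∧ ∀ a : ℤ → ℂ, F a = g (fun n => a n.val)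

lemma Cyl.mono {E E' : Finset ℤ} (hE : E ⊆ E') {F} (h : Cyl E F) : Cyl E' F := by
  obtain ⟨g, hg, hF⟩ := h
  refine ⟨fun b => g (fun n => b ⟨n.1, hE n.2⟩), ?_, fun a => hF a⟩
  refine hg.comp ?_
  rw [contDiff_pi]
  intro n
  exact contDiff_apply ℝ ℂ (⟨n.1, hE n.2⟩ : {x // x ∈ E'})

lemma line_of {E : Finset ℤ} {F : (ℤ → ℂ) → ℝ} {g : ({x // x ∈ E} → ℂ) → ℝ}
    (hg : ContDiff ℝ (⊤ : ℕ∞) g) (hF : ∀ a : ℤ → ℂ, F a = g (fun n => a n.val)) (a v : ℤ → ℂ) :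
    HasLineDerivAt ℝ F (fderiv ℝ g (fun n => a n.val) (fun n => v n.val)) a v := by
  have h1 : HasFDerivAt g (fderiv ℝ g (fun n => a n.val)) (fun n => a n.val) :=
    (hg.differentiable (by simp) _).hasFDerivAt
  have := h1.hasLineDerivAt (fun n => v n.val)
  unfold HasLineDerivAt at *
  convert this using 2
  rw [hF]; rfl

lemma DD_of {E : Finset ℤ} {F : (ℤ → ℂ) → ℝ} {g : ({x // x ∈ E} → ℂ) → ℝ}
    (hg : ContDiff ℝ (⊤ : ℕ∞) g) (hF : ∀ a : ℤ → ℂ, F a = g (fun n => a n.val)) (l) (a : ℤ → ℂ) :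
    DD l F a = fderiv ℝ g (fun n => a n.val) (fun n => ev l.1 l.2 n.val) :=
  (line_of hg hF a _).lineDeriv

lemma Cyl.line {E F} (h : Cyl E F) (l : ℤ × Bool) (a) :
    HasLineDerivAt ℝ F (DD l F a) a (ev l.1 l.2) := by
  obtain ⟨g, hg, hF⟩ := h
  rw [DD_of hg hF]
  exact line_of hg hF a _

lemma Cyl.D {E F} (h : Cyl E F) (l : ℤ × Bool) : Cyl E (DD l F) := by
  obtain ⟨g, hg, hF⟩ := h
  refine ⟨fun b => fderiv ℝ g b (fun n => ev l.1 l.2 n.val), ?_, fun a => DD_of hg hF l a⟩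
  exact (hg.fderiv_right (m := (⊤ : ℕ∞)) (by simp)).clm_apply contDiff_const

lemma Cyl.zero {E F} (h : Cyl E F) (l : ℤ × Bool) (hl : l.1 ∉ E) (a) : DD l F a = 0 := by
  obtain ⟨g, hg, hF⟩ := h
  rw [DD_of hg hF]
  have : (fun n : {x // x ∈ E} => ev l.1 l.2 n.val) = 0 := by
    funext n
    have : n.1 ≠ l.1 := fun h => hl (h ▸ n.2)
    simp [ev, Pi.single_apply, this]
  rw [this, map_zero]

lemma Cyl.comm {E F} (h : Cyl E F) (l m : ℤ × Bool) (a) : DD l (DD m F) a = DD m (DD l F) a := by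
  obtain ⟨g, hg, hF⟩ := h
  have hD : ∀ l : ℤ × Bool, ContDiff ℝ (⊤ : ℕ∞)
      (fun b => fderiv ℝ g b (fun n => ev l.1 l.2 n.val)) := fun l =>
    (hg.fderiv_right (m := (⊤ : ℕ∞)) (by simp)).clm_apply contDiff_const
  have hd : Differentiable ℝ (fderiv ℝ g) :=
    (hg.fderiv_right (m := (⊤ : ℕ∞)) (by simp)).differentiable (by simp)
  rw [DD_of (hD m) (fun a => DD_of hg hF m a), DD_of (hD l) (fun a => DD_of hg hF l a)]
  have e : ∀ (x v w : {x // x ∈ E} → ℂ), fderiv ℝ (fun b => fderiv ℝ g b v) x w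
      = fderiv ℝ (fderiv ℝ g) x w v := by
    intro x v w
    rw [fderiv_clm_apply (hd x) (differentiableAt_const v)]
    simp
  rw [e, e]
  have hs : IsSymmSndFDerivAt ℝ g (fun n : {x // x ∈ E} => a n.val) :=
    (hg.contDiffAt).isSymmSndFDerivAt (by
      rw [minSmoothness_of_isRCLikeNormedField]; exact WithTop.coe_le_coe.2 (le_top : (2 : ℕ∞) ≤ ⊤))
  exact hs _ _

lemma dx_eq (n F a) : dx n F a = DD (n, false) F a := by
  unfold dx DD lineDeriv
  congr 1
  funext s
  congr 1
  funext m
  by_cases h : m = n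
  · subst h; simp [ev]
  · simp [ev, h, Function.update_of_ne]

lemma dy_eq (n F a) : dy n F a = DD (n, true) F a := by
  unfold dy DD lineDeriv
  congr 1
  funext s
  congr 1
  funext m
  by_cases h : m = n
  · subst h; simp [ev]
  · simp [ev, h, Function.update_of_ne]

lemma X_line (l : ℤ × Bool) (a) (n u) :
    HasDerivAt (fun t : ℝ => X (a + t • ev l.1 l.2) n u) (dl l.1 l.2 n u) 0 := by
  have : (fun t : ℝ => X (a + t • ev l.1 l.2) n u) = fun t => X a n u + t * dl l.1 l.2 n u := by
    funext t
    obtain ⟨p, s⟩ := l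
    by_cases h : p = n
    · subst h
      cases u <;> cases s <;> simp [X, ev, dl]
    · cases u <;> simp [X, ev, dl, h, Pi.single_apply, Ne.symm h]
  rw [this]
  simpa using ((hasDerivAt_id (0:ℝ)).mul_const (dl l.1 l.2 n u)).const_add (X a n u)

lemma rho_line (l : ℤ × Bool) (a) (n) :
    HasDerivAt (fun t : ℝ => rho (a + t • ev l.1 l.2) n) (drho a l.1 l.2 n) 0 := by
  unfold rho
  have := (((X_line l a n false).pow 2).const_add 1).add ((X_line l a n true).pow 2)
  refine this.congr_deriv ?_
  simp [drho]

lemma Q_line (l : ℤ × Bool) (a) (i j) :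
    HasLineDerivAt ℝ (fun b => Q b i j) (dQ a l i j) a (ev l.1 l.2) := by
  unfold HasLineDerivAt Q dQ
  split_ifs
  · exact (rho_line l a i.1).const_mul _
  · exact hasDerivAt_const _ _

lemma loc_line (l : ℤ × Bool) (a) (n u v) :
    HasDerivAt (fun t : ℝ => loc (a + t • ev l.1 l.2) n u v) (dloc a l.1 l.2 n u v) 0 := by
  unfold loc
  have := (((rho_line l a n).div_const 2).const_mul (sg u v)).mul
    ((((X_line l a n false).mul (X_line l a (n-1) false)).const_sub 1).sub
      ((X_line l a n true).mul (X_line l a (n-1) true)))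
  refine this.congr_deriv ?_
  simp [dloc]
  ring

lemma gt_line (l : ℤ × Bool) (a) (n u m v) :
    HasDerivAt (fun t : ℝ => gt (a + t • ev l.1 l.2) n u m v) (dgt a l.1 l.2 n u m v) 0 := by
  unfold gt dgt
  have h1 := (((X_line l a n (!u)).const_mul (sr u)).mul ((rho_line l a m).div_const 2)).mul
    ((X_line l a (m-1) v).sub (X_line l a (m+1) v))
  split_ifs
  · have h2 := (((rho_line l a n).const_mul (sg u v)).mul (rho_line l a m)).div_const 4
    refine (h1.sub h2).congr_deriv ?_
    simp
    ring
  · refine (h1.sub (hasDerivAt_const _ 0)).congr_deriv ?_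
    simp
    ring

lemma P_line (l : ℤ × Bool) (a) (i j) :
    HasLineDerivAt ℝ (fun b => P b i j) (dP a l i j) a (ev l.1 l.2) := by
  unfold HasLineDerivAt P dP
  split_ifs
  · exact loc_line _ _ _ _ _
  · exact gt_line _ _ _ _ _ _
  · exact (gt_line _ _ _ _ _ _).neg

/-- finite bracket -/
def B (S : Finset (ℤ × Bool)) (R : (ℤ → ℂ) → ℤ × Bool → ℤ × Bool → ℝ) (F G : (ℤ → ℂ) → ℝ)
    (a : ℤ → ℂ) : ℝ := ∑ j ∈ S, ∑ k ∈ S, R a j k * DD j F a * DD k G a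

lemma B_DD {E F G} (S) (R : (ℤ → ℂ) → ℤ × Bool → ℤ × Bool → ℝ) (dR : ℤ × Bool → ℤ × Bool → ℤ × Bool → ℝ)
    (a) (l : ℤ × Bool)
    (hR : ∀ i j, HasLineDerivAt ℝ (fun b => R b i j) (dR l i j) a (ev l.1 l.2))
    (hF : Cyl E F) (hG : Cyl E G) :
    DD l (B S R F G) a = ∑ j ∈ S, ∑ k ∈ S, (dR l j k * DD j F a * DD k G a
      + R a j k * DD l (DD j F) a * DD k G a + R a j k * DD j F a * DD l (DD k G) a) := by
  refine HasLineDerivAt.lineDeriv ?_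
  unfold HasLineDerivAt B
  refine HasDerivAt.fun_sum fun j _ => HasDerivAt.fun_sum fun k _ => ?_
  have h1 := hR j k
  have h2 := (hF.D j).line l a
  have h3 := (hG.D k).line l a
  unfold HasLineDerivAt at h1 h2 h3
  refine ((h1.mul h2).mul h3).congr_deriv ?_
  simp
  ring

lemma cxx_eq (a n m) : cxx a n m = P a (n,false) (m,false) := by
  unfold cxx P
  rcases lt_trichotomy n m with h | h | h
  · rw [if_neg (by omega), if_neg (by omega), if_neg h.ne, if_neg h.not_gt]
    simp [gt, rho, X, sg, sr, Complex.normSq_apply, -mul_eq_mul_right_iff, -mul_eq_mul_left_iff]; ring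
  · subst h; simp [loc, sg]
  · rw [if_pos (by omega), if_neg h.ne', if_pos h]
    simp [gt, rho, X, sg, sr, Complex.normSq_apply, -mul_eq_mul_right_iff, -mul_eq_mul_left_iff]; ring

lemma cyy_eq (a n m) : cyy a n m = P a (n,true) (m,true) := by
  unfold cyy P
  rcases lt_trichotomy n m with h | h | h
  · rw [if_neg (by omega), if_neg (by omega), if_neg h.ne, if_neg h.not_gt]
    simp [gt, rho, X, sg, sr, Complex.normSq_apply, -mul_eq_mul_right_iff, -mul_eq_mul_left_iff]; ring
  · subst h; simp [loc, sg]
  · rw [if_pos (by omega), if_neg h.ne', if_pos h]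
    simp [gt, rho, X, sg, sr, Complex.normSq_apply, -mul_eq_mul_right_iff, -mul_eq_mul_left_iff]; ring

lemma cxy_eq (a n m) : cxy a n m = P a (n,false) (m,true) := by
  unfold cxy
  have : m + 2 ≤ n ∨ n = m + 1 ∨ n = m ∨ m = n + 1 ∨ n + 2 ≤ m := by omega
  rcases this with h | rfl | rfl | rfl | h
  · rw [if_pos h, P_gt _ _ _ _ _ (by omega), gt_two _ _ _ _ _ (by omega)]
    simp [rho, X, sr, Complex.normSq_apply, -mul_eq_mul_right_iff, -mul_eq_mul_left_iff]; ring
  · rw [if_neg (by omega), if_pos rfl, P_gt _ _ _ _ _ (by omega), gt_one]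
    simp [rho, X, sr, sg, Complex.normSq_apply]; ring
  · rw [if_neg (by omega), if_neg (by omega), if_pos rfl, P_eq]
    simp [loc, rho, X, sg, Complex.normSq_apply]; ring
  · rw [if_neg (by omega), if_neg (by omega), if_neg (by omega), if_pos (by omega),
      P_lt _ _ _ _ _ (by omega), gt_one]
    simp [rho, X, sr, sg, Complex.normSq_apply]; ring
  · rw [if_neg (by omega), if_neg (by omega), if_neg (by omega), if_neg (by omega),
      P_lt _ _ _ _ _ (by omega), gt_two _ _ _ _ _ (by omega)]
    simp [rho, X, sr, Complex.normSq_apply, -mul_eq_mul_right_iff, -mul_eq_mul_left_iff]; ring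

lemma pbAL_eq {E : Finset ℤ} {F G : (ℤ → ℂ) → ℝ} (a)
    (hF : ∀ l : ℤ × Bool, l.1 ∉ E → DD l F a = 0) (hG : ∀ l : ℤ × Bool, l.1 ∉ E → DD l G a = 0) :
    pbAL F G a = B (E ×ˢ Finset.univ) P F G a := by
  unfold pbAL B
  rw [tsum_eq_sum (s := E ×ˢ E)]
  · simp only [Finset.sum_product, Fintype.sum_bool, ← Finset.sum_add_distrib]
    refine Finset.sum_congr rfl fun n _ => Finset.sum_congr rfl fun m _ => ?_
    rw [dx_eq, dx_eq, dy_eq, dy_eq, cxx_eq, cyy_eq, cxy_eq, cxy_eq,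
      P_anti a (n, true) (m, false)]
    ring
  · rintro ⟨n, m⟩ h
    simp only [dx_eq, dy_eq]
    rw [Finset.mem_product, not_and_or] at h
    rcases h with h | h
    · rw [hF (n, false) h, hF (n, true) h]; ring
    · rw [hG (m, false) h, hG (m, true) h]; ring

lemma pbAL0_eq {E : Finset ℤ} {F G : (ℤ → ℂ) → ℝ} (a)
    (hF : ∀ l : ℤ × Bool, l.1 ∉ E → DD l F a = 0) :
    pbAL0 F G a = B (E ×ˢ Finset.univ) Q F G a := by
  unfold pbAL0 B
  rw [tsum_eq_sum (s := E)]
  · simp only [Finset.sum_product, Fintype.sum_bool, ← Finset.sum_add_distrib]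
    refine Finset.sum_congr rfl fun n hn => ?_
    rw [Finset.sum_eq_single n]
    · rw [dx_eq, dx_eq, dy_eq, dy_eq]
      simp [Q, sg, rho, X, Complex.normSq_apply]; ring
    · intro m _ hm
      simp [Q, Ne.symm hm]
    · exact fun h => absurd hn h
  · intro n h
    simp only [dx_eq, dy_eq]
    rw [hF (n, false) h, hF (n, true) h]; ring

lemma sum_PdQ {E : Finset ℤ} (a) (i j k : ℤ × Bool) (hj : j.1 ∈ E) :
    ∑ l ∈ E ×ˢ Finset.univ, P a i l * dQ a l j k = pd a i j k := by
  simp only [Finset.sum_product, Fintype.sum_bool]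
  rw [Finset.sum_eq_single j.1]
  · unfold dQ pd
    split_ifs
    · simp [drho, dl]; ring
    · simp
  · intro n _ hn
    simp [dQ, drho, dl, hn]
  · exact fun h => absurd hj h

lemma sum_QdP {E : Finset ℤ} (a) (i j k : ℤ × Bool) (hi : i.1 ∈ E) :
    ∑ l ∈ E ×ˢ Finset.univ, Q a i l * dP a l j k = qd a i j k := by
  simp only [Finset.sum_product, Fintype.sum_bool]
  rw [Finset.sum_eq_single i.1]
  · obtain ⟨n, u⟩ := i
    unfold qd Q
    cases u <;> simp [sg]
  · intro n _ hn
    simp [Q, Ne.symm hn]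
  · exact fun h => absurd hi h

lemma main {E : Finset ℤ} {F G H : (ℤ → ℂ) → ℝ} (hF : Cyl E F) (hG : Cyl E G) (hH : Cyl E H)
    (a : ℤ → ℂ) :
    pbAL F (pbAL0 G H) a + pbAL G (pbAL0 H F) a + pbAL H (pbAL0 F G) a
      + pbAL0 F (pbAL G H) a + pbAL0 G (pbAL H F) a + pbAL0 H (pbAL F G) a = 0 := by
  have e0 : ∀ {F G}, Cyl E F → Cyl E G → pbAL0 F G = B (E ×ˢ Finset.univ) Q F G :=
    fun hF _ => funext fun a => pbAL0_eq a (fun l hl => hF.zero l hl a)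
  have e1 : ∀ {F G}, Cyl E F → Cyl E G → pbAL F G = B (E ×ˢ Finset.univ) P F G :=
    fun hF hG => funext fun a => pbAL_eq a (fun l hl => hF.zero l hl a)
      (fun l hl => hG.zero l hl a)
  have z0 : ∀ {F G}, Cyl E F → Cyl E G → ∀ l : ℤ × Bool, l.1 ∉ E →
      DD l (B (E ×ˢ Finset.univ) Q F G) a = 0 := by
    intro F G hF hG l hl
    rw [B_DD _ Q (dQ a) a l (fun i j => Q_line l a i j) hF hG]
    refine Finset.sum_eq_zero fun j hj => Finset.sum_eq_zero fun k _ => ?_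
    have hj : l.1 ≠ j.1 := fun h => hl (h ▸ (Finset.mem_product.1 hj).1)
    rw [(hF.D j).zero l hl, (hG.D k).zero l hl]
    simp [dQ, drho, dl, hj]
  have f0 : ∀ {F G H}, Cyl E F → Cyl E G → Cyl E H → pbAL F (pbAL0 G H) a =
      T (E ×ˢ Finset.univ) (P a) (Q a) (dQ a) (fun i => DD i F a) (fun i => DD i G a)
        (fun i => DD i H a) (fun l i => DD l (DD i G) a) (fun l i => DD l (DD i H) a) := by
    intro F G H hF hG hH
    rw [e0 hG hH, pbAL_eq a (fun l hl => hF.zero l hl a) (z0 hG hH)]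
    unfold B T
    refine Finset.sum_congr rfl fun i _ => Finset.sum_congr rfl fun l _ => ?_
    rw [← B_DD _ Q (dQ a) a l (fun i j => Q_line l a i j) hG hH]
    rfl
  have f1 : ∀ {F G H}, Cyl E F → Cyl E G → Cyl E H → pbAL0 F (pbAL G H) a =
      T (E ×ˢ Finset.univ) (Q a) (P a) (dP a) (fun i => DD i F a) (fun i => DD i G a)
        (fun i => DD i H a) (fun l i => DD l (DD i G) a) (fun l i => DD l (DD i H) a) := by
    intro F G H hF hG hH
    rw [e1 hG hH, pbAL0_eq a (fun l hl => hF.zero l hl a)]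
    unfold B T
    refine Finset.sum_congr rfl fun i _ => Finset.sum_congr rfl fun l _ => ?_
    rw [← B_DD _ P (dP a) a l (fun i j => P_line l a i j) hG hH]
    rfl
  rw [f0 hF hG hH, f0 hG hH hF, f0 hH hF hG, f1 hF hG hH, f1 hG hH hF, f1 hH hF hG]
  refine abs_main _ _ _ _ _ _ _ _ _ _ _ (P_anti a) (Q_anti a) (fun i j => hF.comm i j a)
    (fun i j => hG.comm i j a) (fun i j => hH.comm i j a) ?_
  intro i hi j hj k hk
  have hi := (Finset.mem_product.1 hi).1
  have hj := (Finset.mem_product.1 hj).1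
  have hk := (Finset.mem_product.1 hk).1
  rw [sum_PdQ a i j k hj, sum_PdQ a j k i hk, sum_PdQ a k i j hi, sum_QdP a i j k hi,
    sum_QdP a j k i hj, sum_QdP a k i j hk]
  exact J_zero a i j k

end ALC

/-- the two Poisson brackets are compatible: the mixed Jacobi identity
{F,{G,H}₀} + {G,{H,F}₀} + {H,{F,G}₀} + {F,{G,H}}₀ + {G,{H,F}}₀ + {H,{F,G}}₀ = 0 holds for
all smooth cylinder functions F, G, H. -/
theorem poisson_brackets_compatible
    (F G H : (ℤ → ℂ) → ℝ)
    (hF : SmoothCylinder F) (hG : SmoothCylinder G) (hH : SmoothCylinder H)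
    (a : ℤ → ℂ) :
    pbAL F (pbAL0 G H) a + pbAL G (pbAL0 H F) a + pbAL H (pbAL0 F G) a
      + pbAL0 F (pbAL G H) a + pbAL0 G (pbAL H F) a + pbAL0 H (pbAL F G) a = 0 := by
  obtain ⟨E1, hF⟩ := hF
  obtain ⟨E2, hG⟩ := hG
  obtain ⟨E3, hH⟩ := hH
  have hF : ALC.Cyl E1 F := hF
  have hG : ALC.Cyl E2 G := hG
  have hH : ALC.Cyl E3 H := hH
  refine ALC.main (E := E1 ∪ E2 ∪ E3) (hF.mono ?_) (hG.mono ?_) (hH.mono ?_) a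
  · exact Finset.subset_union_left.trans Finset.subset_union_left
  · exact Finset.subset_union_right.trans Finset.subset_union_left
  · exact Finset.subset_union_right
end
end

section
/- Fix an integer K ≥ 1 and β > 0. (i) For every a ∈ ℂ^{{−K,…,K}} there exists a unique global C¹ solution α : ℝ → ℂ^{{−K,…,K}} with α(0) = a of the truncated Ablowitz–Ladik system: i·(d/dt)α_{−K} = −(1+|α_{−K}|²)α_{−K+1} + 2α_{−K}; i·(d/dt)α_n = −(1+|α_n|²)(α_{n+1}+α_{n−1}) + 2α_n for |n| ≤ K−1; i·(d/dt)α_K = −(1+|α_K|²)α_{K−1} + 2α_K. (ii) Denoting by Φ_t : ℂ^{{−K,…,K}} → ℂ^{{−K,…,K}} the resulting flow map (Φ_t(a) = α(t) for the solution with α(0)=a), for every t ∈ ℝ the pushforward under Φ_t of the probability measure μ_wn^{β,K} equals μ_wn^{β,K}. -/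
open MeasureTheory
open scoped ENNReal BigOperators
noncomputable section

/-- The index set {−K,…,K}. -/
abbrev IdxK (K : ℤ) := {x // x ∈ Finset.Icc (-K) K}

/-- Extension of a configuration on {−K,…,K} by zero. -/
def extK {K : ℤ} (v : IdxK K → ℂ) (n : ℤ) : ℂ :=
  if h : n ∈ Finset.Icc (-K) K then v ⟨n, h⟩ else 0

/-- The truncated Ablowitz–Ladik system on {−K,…,K}:
i·(d/dt)α_{−K} = −(1+|α_{−K}|²)α_{−K+1} + 2α_{−K},
i·(d/dt)α_n = −(1+|α_n|²)(α_{n+1}+α_{n−1}) + 2α_n for |n| ≤ K−1,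
i·(d/dt)α_K = −(1+|α_K|²)α_{K−1} + 2α_K,
written uniformly using the extension-by-zero of the configuration. -/
def TruncALEquation (K : ℤ) (α : ℝ → (IdxK K → ℂ)) : Prop :=
  ∀ (n : IdxK K) (t : ℝ), ∃ d : ℂ,
    HasDerivAt (fun s : ℝ => α s n) d t ∧
    Complex.I * d
      = -(1 + (Complex.normSq (α t n) : ℂ)) * (extK (α t) (n.val + 1) + extK (α t) (n.val - 1))
        + 2 * α t n

/-- The white noise measure μ_wn^{β,K} on ℂ^{{−K,…,K}}: the product over −K ≤ n ≤ K of the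
probability measures with density z ↦ (1+2β)/(π(1+|z|²)^{2+2β}) with respect to Lebesgue
measure on ℂ. -/
def muWnK (β : ℝ) (K : ℤ) : Measure (IdxK K → ℂ) :=
  (volume : Measure (IdxK K → ℂ)).withDensity
    (fun v => ∏ n : IdxK K,
      ENNReal.ofReal ((1 + 2*β)/(Real.pi * (1 + Complex.normSq (v n)) ^ (2 + 2*β))))


theorem al_global_exists {E : Type*} [NormedAddCommGroup E] [NormedSpace ℝ E] [CompleteSpace E]
    (g : E → E) (k L : NNReal) (hg : LipschitzWith k g) (hL : ∀ x, ‖g x‖ ≤ L) (x : E) :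
    ∃ γ : ℝ → E, γ 0 = x ∧ ∀ t, HasDerivAt γ (g (γ t)) t := by
  have key : ∀ n : ℕ, ∃ γ : ℝ → E, γ 0 = x ∧
      ∀ t ∈ Set.Ioo (-((n : ℝ) + 1)) (n + 1), HasDerivAt γ (g (γ t)) t := by
    intro n
    have hn : (0 : ℝ) ≤ n := Nat.cast_nonneg n
    have hp : IsPicardLindelof (fun _ : ℝ => g) (tmin := -((n : ℝ) + 1)) (tmax := n + 1)
        ⟨0, by constructor <;> linarith⟩ x (L * ((n : NNReal) + 1)) 0 L k := by
      refine ⟨fun t _ => hg.lipschitzOnWith, fun y _ => continuousOn_const, fun t _ y _ => hL y, ?_⟩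
      simp
    obtain ⟨γ, h0, h1⟩ := hp.exists_eq_forall_mem_Icc_hasDerivWithinAt₀
    exact ⟨γ, h0, fun t ht => (h1 t (Set.Ioo_subset_Icc_self ht)).hasDerivAt
      (Icc_mem_nhds ht.1 ht.2)⟩
  choose γ h0 h1 using key
  have hmono : ∀ m n : ℕ, m ≤ n → Set.EqOn (γ m) (γ n) (Set.Ioo (-((m : ℝ) + 1)) (m + 1)) := by
    intro m n hmn
    have hm : (0 : ℝ) ≤ m := Nat.cast_nonneg m
    have hmn' : (m : ℝ) ≤ n := by exact_mod_cast hmn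
    refine ODE_solution_unique_of_mem_Ioo (v := fun _ => g) (s := fun _ => Set.univ) (K := k)
      (t₀ := 0) (fun t _ => hg.lipschitzOnWith) (by constructor <;> linarith)
      (fun t ht => ⟨h1 m t ht, trivial⟩)
      (fun t ht => ⟨h1 n t ⟨by linarith [ht.1], by linarith [ht.2]⟩, trivial⟩) (by rw [h0, h0])
  have hany : ∀ m n : ℕ, ∀ t : ℝ, |t| < m + 1 → |t| < n + 1 → γ m t = γ n t := by
    intro m n t hm hn
    rcases le_total m n with h | h
    · exact hmono m n h (abs_lt.mp hm)
    · exact (hmono n m h (abs_lt.mp hn)).symm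
  refine ⟨fun t => γ ⌈|t|⌉₊ t, by simp [h0], fun t => ?_⟩
  have hN : |t| < (⌈|t|⌉₊ : ℝ) + 1 := by linarith [Nat.le_ceil |t|]
  refine (h1 ⌈|t|⌉₊ t (abs_lt.mp hN)).congr_of_eventuallyEq ?_
  have : ∀ᶠ s in nhds t, |s| < (⌈|t|⌉₊ : ℝ) + 1 :=
    (continuous_abs.tendsto t).eventually (gt_mem_nhds hN)
  filter_upwards [this] with s hs
  exact hany _ _ s (by linarith [Nat.le_ceil |s|]) hs

section flow
variable {E : Type*} [NormedAddCommGroup E] [NormedSpace ℝ E]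

theorem al_unique (g : E → E) (k : NNReal) (hg : LipschitzWith k g) (γ η : ℝ → E)
    (h1 : ∀ t, HasDerivAt γ (g (γ t)) t) (h2 : ∀ t, HasDerivAt η (g (η t)) t)
    (h : γ 0 = η 0) : γ = η :=
  ODE_solution_unique_univ (v := fun _ => g) (s := fun _ => Set.univ) (K := k) (t₀ := 0)
    (fun _ => hg.lipschitzOnWith) (fun t => ⟨h1 t, trivial⟩) (fun t => ⟨h2 t, trivial⟩) h

theorem al_group (g : E → E) (k : NNReal) (hg : LipschitzWith k g) (Ψ : ℝ → E → E)
    (h0 : ∀ x, Ψ 0 x = x) (hΨ : ∀ x t, HasDerivAt (fun s => Ψ s x) (g (Ψ t x)) t)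
    (t h : ℝ) (x : E) : Ψ (t + h) x = Ψ t (Ψ h x) := by
  have := al_unique g k hg (fun s => Ψ (s + h) x) (fun s => Ψ s (Ψ h x))
    (fun s => (hΨ x (s + h)).comp_add_const s h) (fun s => hΨ _ s) (by simp [h0])
  exact congrFun this t

theorem al_lip_pos (g : E → E) (k : NNReal) (hg : LipschitzWith k g) (γ η : ℝ → E)
    (h1 : ∀ t, HasDerivAt γ (g (γ t)) t) (h2 : ∀ t, HasDerivAt η (g (η t)) t)
    (t : ℝ) (ht : 0 ≤ t) : dist (γ t) (η t) ≤ Real.exp (k * t) * dist (γ 0) (η 0) := by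
  have := dist_le_of_trajectories_ODE (v := fun _ => g) (K := k) (f := γ) (g := η) (a := 0) (b := t)
    (δ := dist (γ 0) (η 0))
    (fun _ => hg) (fun s _ => (h1 s).continuousAt.continuousWithinAt)
    (fun s _ => (h1 s).hasDerivWithinAt) (fun s _ => (h2 s).continuousAt.continuousWithinAt)
    (fun s _ => (h2 s).hasDerivWithinAt) le_rfl t ⟨ht, le_rfl⟩
  simpa [mul_comm] using this

theorem al_lip (g : E → E) (k : NNReal) (hg : LipschitzWith k g) (Ψ : ℝ → E → E)
    (h0 : ∀ x, Ψ 0 x = x) (hΨ : ∀ x t, HasDerivAt (fun s => Ψ s x) (g (Ψ t x)) t)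
    (t : ℝ) : ∃ C : NNReal, LipschitzWith C (Ψ t) := by
  refine ⟨⟨Real.exp (k * |t|), (Real.exp_pos _).le⟩, LipschitzWith.of_dist_le_mul fun x y => ?_⟩
  rcases le_total 0 t with ht | ht
  · have := al_lip_pos g k hg _ _ (hΨ x) (hΨ y) t ht
    rw [abs_of_nonneg ht]
    simp only [h0] at this
    exact this
  · have hneg : LipschitzWith k (fun x => - g x) := by
      intro x y; simpa [edist_neg_neg] using hg x y
    have h' : ∀ x s, HasDerivAt (fun s => Ψ (-s) x) (- g (Ψ (-s) x)) s := by
      intro x s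
      have := (hΨ x (-s)).scomp s (hasDerivAt_neg s)
      rw [neg_one_smul] at this
      exact this
    have := al_lip_pos _ k hneg _ _ (h' x) (h' y) (-t) (by linarith)
    rw [abs_of_nonpos ht]
    simp only [neg_neg, neg_zero, h0] at this
    exact this

end flow

section liouville
variable {ι : Type*} [Fintype ι] [DecidableEq ι]

theorem al_decomp (w : ι → ℂ) : w = ∑ n, ((w n).re • (Pi.single n (1:ℂ) : ι → ℂ)
    + (w n).im • (Pi.single n Complex.I : ι → ℂ)) := by
  ext m
  rw [Finset.sum_apply, Finset.sum_eq_single m]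
  · simp
  · intro b _ hb
    simp [hb.symm]
  · simp

theorem al_ibp (g : (ι → ℂ) → (ι → ℂ)) (hg : ContDiff ℝ 1 g) (hc : HasCompactSupport g)
    (hdiv : ∀ x, ∑ n, ((fderiv ℝ g x (Pi.single n 1) n).re
      + (fderiv ℝ g x (Pi.single n Complex.I) n).im) = 0)
    (u : (ι → ℂ) → ℝ) (C : NNReal) (hu : LipschitzWith C u) :
    ∫ x, fderiv ℝ u x (g x) = 0 := by
  have hdiff : Differentiable ℝ g := hg.differentiable (by simp)
  obtain ⟨k, hk⟩ := hg.lipschitzWith_of_hasCompactSupport hc (by simp)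
  -- components
  have hP : ∀ (p : (ι → ℂ) →L[ℝ] ℝ) (v : ι → ℂ),
      Integrable (fun x => lineDeriv ℝ u x v * p (g x)) ∧
      Integrable (fun x => p (fderiv ℝ g x v) * u x) ∧
      ∫ x, lineDeriv ℝ u x v * p (g x) = - ∫ x, p (fderiv ℝ g x v) * u x := by
    intro p v
    have hpc : HasCompactSupport (fun x => p (g x)) := hc.comp_left (g := p) (by simp)
    have hpl : LipschitzWith (‖p‖₊ * k) (fun x => p (g x)) := p.lipschitz.comp hk
    have hpcont : Continuous (fun x => p (g x)) := p.continuous.comp hg.continuous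
    have hfc : HasCompactSupport (fun x => p (fderiv ℝ g x v)) := by
      have := hc.fderiv (𝕜 := ℝ)
      exact this.comp_left (g := fun T : (ι → ℂ) →L[ℝ] (ι → ℂ) => p (T v)) (by simp)
    have hfcont : Continuous (fun x => p (fderiv ℝ g x v)) :=
      p.continuous.comp ((hg.continuous_fderiv (by simp)).clm_apply continuous_const)
    refine ⟨?_, ?_, ?_⟩
    · refine (hpcont.integrable_of_hasCompactSupport hpc).bdd_mul (c := C * ‖v‖) ?_ ?_
      · exact (measurable_lineDeriv hu.continuous).aestronglyMeasurable
      · exact Filter.Eventually.of_forall fun x => norm_lineDeriv_le_of_lipschitz ℝ hu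
    · exact (hfcont.mul hu.continuous).integrable_of_hasCompactSupport hfc.mul_right
    · rw [hu.integral_lineDeriv_mul_eq hpl hpc v, ← integral_neg]
      congr 1; ext x
      have : HasFDerivAt (fun x => p (g x)) (p.comp (fderiv ℝ g x)) x :=
        p.hasFDerivAt.comp x (hdiff x).hasFDerivAt
      rw [this.differentiableAt.lineDeriv_eq_fderiv, this.fderiv]
      simp
  let re' : ι → ((ι → ℂ) →L[ℝ] ℝ) := fun n => Complex.reCLM.comp (ContinuousLinearMap.proj n)
  let im' : ι → ((ι → ℂ) →L[ℝ] ℝ) := fun n => Complex.imCLM.comp (ContinuousLinearMap.proj n)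
  have hae : ∀ᵐ x : ι → ℂ, fderiv ℝ u x (g x) = ∑ n,
      (lineDeriv ℝ u x (Pi.single n 1) * re' n (g x)
        + lineDeriv ℝ u x (Pi.single n Complex.I) * im' n (g x)) := by
    filter_upwards [hu.ae_differentiableAt] with x hx
    conv_lhs => rw [al_decomp (g x)]
    rw [map_sum]
    refine Finset.sum_congr rfl fun n _ => ?_
    rw [hx.lineDeriv_eq_fderiv, hx.lineDeriv_eq_fderiv, map_add, map_smul, map_smul]
    simp [re', im', mul_comm]
  rw [integral_congr_ae hae, integral_finsetSum]
  swap
  · exact fun n _ => (hP _ _).1.add (hP _ _).1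
  have : ∀ n, ∫ x, (lineDeriv ℝ u x (Pi.single n 1) * re' n (g x)
        + lineDeriv ℝ u x (Pi.single n Complex.I) * im' n (g x)) =
      - ∫ x, (re' n (fderiv ℝ g x (Pi.single n 1)) * u x
        + im' n (fderiv ℝ g x (Pi.single n Complex.I)) * u x) := by
    intro n
    rw [integral_add (hP _ _).1 (hP _ _).1, (hP _ _).2.2, (hP _ _).2.2,
      integral_add (hP _ _).2.1 (hP _ _).2.1]
    ring
  simp_rw [this]
  rw [Finset.sum_neg_distrib, ← integral_finsetSum]
  swap
  · exact fun n _ => (hP _ _).2.1.add (hP _ _).2.1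
  have : ∀ x, ∑ n, (re' n (fderiv ℝ g x (Pi.single n 1)) * u x
        + im' n (fderiv ℝ g x (Pi.single n Complex.I)) * u x) = 0 := by
    intro x
    simp_rw [← add_mul]
    rw [← Finset.sum_mul]
    have := hdiv x
    simp only [re', im', ContinuousLinearMap.comp_apply, ContinuousLinearMap.proj_apply,
      Complex.reCLM_apply, Complex.imCLM_apply]
    rw [this, zero_mul]
  simp [this]

theorem al_integral_const (g : (ι → ℂ) → (ι → ℂ)) (hg : ContDiff ℝ 1 g) (hc : HasCompactSupport g)
    (hdiv : ∀ x, ∑ n, ((fderiv ℝ g x (Pi.single n 1) n).re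
      + (fderiv ℝ g x (Pi.single n Complex.I) n).im) = 0)
    (Ψ : ℝ → (ι → ℂ) → (ι → ℂ))
    (h0 : ∀ x, Ψ 0 x = x) (hΨ : ∀ x t, HasDerivAt (fun s => Ψ s x) (g (Ψ t x)) t)
    (φ : (ι → ℂ) → ℝ) (C : NNReal) (hφ : LipschitzWith C φ) (t : ℝ) :
    ∫ x in tsupport g, φ (Ψ t x) = ∫ x in tsupport g, φ x := by
  obtain ⟨k, hk⟩ := hg.lipschitzWith_of_hasCompactSupport hc (by simp)
  obtain ⟨L, hL⟩ := hc.exists_bound_of_continuous hg.continuous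
  have hcomp : IsCompact (tsupport g) := hc
  have hfin : IsFiniteMeasure ((volume : Measure (ι → ℂ)).restrict (tsupport g)) :=
    isFiniteMeasure_restrict.mpr hcomp.measure_lt_top.ne
  have hL' : ∀ x, ‖g x‖₊ ≤ L.toNNReal := fun x => by
    rw [← NNReal.coe_le_coe]; simpa using Or.inl (hL x)
  have hder : ∀ t, HasDerivAt (fun t => ∫ x in tsupport g, φ (Ψ t x)) 0 t := by
    intro t
    obtain ⟨D, hD⟩ := al_lip g k hk Ψ h0 hΨ t
    set u : (ι → ℂ) → ℝ := fun x => φ (Ψ t x) with hu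
    have hul : LipschitzWith (C * D) u := hφ.comp hD
    have key : HasDerivAt (fun h => ∫ x in tsupport g, u (Ψ h x))
        (∫ x in tsupport g, fderiv ℝ u x (g x)) 0 := by
      refine (hasDerivAt_integral_of_dominated_loc_of_lip (s := Set.univ)
        (bound := fun _ => ((C * D * L.toNNReal : NNReal) : ℝ)) (𝕜 := ℝ)
        (F := fun h x => u (Ψ h x)) Filter.univ_mem ?_ ?_ ?_ ?_ ?_ ?_).2
      · refine Filter.Eventually.of_forall fun h => ?_
        obtain ⟨D', hD'⟩ := al_lip g k hk Ψ h0 hΨ h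
        exact (hul.continuous.comp hD'.continuous).aestronglyMeasurable
      · simp only [h0]
        exact hul.continuous.continuousOn.integrableOn_compact hcomp
      · refine Measurable.aestronglyMeasurable ?_
        have : (fun x => fderiv ℝ u x (g x)) = fun x => ∑ n,
            ((g x n).re * fderiv ℝ u x (Pi.single n 1)
              + (g x n).im * fderiv ℝ u x (Pi.single n Complex.I)) := by
          ext x
          conv_lhs => rw [al_decomp (g x)]
          simp [map_sum]
        rw [this]
        have hm : ∀ n, Measurable fun x => g x n := fun n =>
          ((continuous_apply n).comp hg.continuous).measurable
        refine Finset.measurable_sum _ fun n _ => ?_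
        exact ((Complex.measurable_re.comp (hm n)).mul (measurable_fderiv_apply_const ℝ u _)).add
          ((Complex.measurable_im.comp (hm n)).mul (measurable_fderiv_apply_const ℝ u _))
      · refine Filter.Eventually.of_forall fun x => ?_
        have hl : LipschitzWith L.toNNReal (fun h => Ψ h x) :=
          lipschitzWith_of_nnnorm_deriv_le (fun s => (hΨ x s).differentiableAt)
            (fun s => by rw [(hΨ x s).deriv]; exact hL' _)
        have := hul.comp hl
        rw [Real.nnabs_of_nonneg (NNReal.coe_nonneg _), Real.toNNReal_coe]
        exact this.lipschitzOnWith
      · exact integrable_const _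
      · filter_upwards [ae_restrict_of_ae hul.ae_differentiableAt] with x hx
        have hx' : HasFDerivAt u (fderiv ℝ u x) (Ψ 0 x) := by rw [h0]; exact hx.hasFDerivAt
        have := hx'.comp_hasDerivAt (0:ℝ) (hΨ x 0)
        rw [h0] at this
        exact this
    have hz : ∫ x in tsupport g, fderiv ℝ u x (g x) = 0 := by
      rw [setIntegral_eq_integral_of_forall_compl_eq_zero, al_ibp g hg hc hdiv u _ hul]
      intro x hx
      rw [image_eq_zero_of_notMem_tsupport hx, map_zero]
    rw [hz] at key
    have h2 : HasDerivAt (fun s => ∫ x in tsupport g, u (Ψ (s + -t) x)) 0 t := by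
      have : HasDerivAt (fun h => ∫ x in tsupport g, u (Ψ h x)) 0 (t + -t) := by simpa using key
      exact this.comp_add_const t (-t)
    convert h2 using 1
    ext s
    congr 1; ext x
    simp only [hu]
    rw [← al_group g k hk Ψ h0 hΨ]
    congr 2; ring
  have := is_const_of_deriv_eq_zero (fun s => (hder s).differentiableAt) (fun s => (hder s).deriv) t 0
  simpa [h0] using this

theorem al_liouville (g : (ι → ℂ) → (ι → ℂ)) (hg : ContDiff ℝ 1 g) (hc : HasCompactSupport g)
    (hdiv : ∀ x, ∑ n, ((fderiv ℝ g x (Pi.single n 1) n).re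
      + (fderiv ℝ g x (Pi.single n Complex.I) n).im) = 0)
    (Ψ : ℝ → (ι → ℂ) → (ι → ℂ))
    (h0 : ∀ x, Ψ 0 x = x) (hΨ : ∀ x t, HasDerivAt (fun s => Ψ s x) (g (Ψ t x)) t) (t : ℝ) :
    Continuous (Ψ t) ∧ ∀ A, MeasurableSet A → volume (Ψ t ⁻¹' A) = volume A := by
  obtain ⟨k, hk⟩ := hg.lipschitzWith_of_hasCompactSupport hc (by simp)
  have hcomp : IsCompact (tsupport g) := hc
  have hfin : IsFiniteMeasure ((volume : Measure (ι → ℂ)).restrict (tsupport g)) :=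
    isFiniteMeasure_restrict.mpr hcomp.measure_lt_top.ne
  obtain ⟨D, hD⟩ := al_lip g k hk Ψ h0 hΨ t
  refine ⟨hD.continuous, fun A hA => ?_⟩
  have hmeas : Measurable (Ψ t) := hD.continuous.measurable
  have hmap : ((volume : Measure (ι → ℂ)).restrict (tsupport g)).map (Ψ t)
      = (volume : Measure (ι → ℂ)).restrict (tsupport g) := by
    refine ext_of_generate_finite {s | IsClosed s} ?_ isPiSystem_isClosed ?_ ?_
    · rw [← borel_eq_generateFrom_isClosed]; exact BorelSpace.measurable_eq
    · intro F hF
      have hlim : Filter.Tendsto (fun n : ℕ => (1 : ℝ) / ((n : ℝ) + 1)) Filter.atTop (nhds 0) :=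
        tendsto_one_div_add_atTop_nhds_zero_nat
      have hpos : ∀ n : ℕ, 0 < (1 : ℝ) / ((n : ℝ) + 1) := fun n => by positivity
      have t1 := tendsto_lintegral_thickenedIndicator_of_isClosed
        (((volume : Measure (ι → ℂ)).restrict (tsupport g)).map (Ψ t)) hF hpos hlim
      have t2 := tendsto_lintegral_thickenedIndicator_of_isClosed
        ((volume : Measure (ι → ℂ)).restrict (tsupport g)) hF hpos hlim
      refine tendsto_nhds_unique t1 (t2.congr fun n => ?_)
      have hl : LipschitzWith _ fun x => ((thickenedIndicator (hpos n) F x : NNReal) : ℝ) :=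
        (NNReal.isometry_coe.lipschitz).comp (lipschitzWith_thickenedIndicator (hpos n) F)
      have hm : Measurable fun x => (thickenedIndicator (hpos n) F x : NNReal) :=
        (thickenedIndicator (hpos n) F).continuous.measurable
      have key := al_integral_const g hg hc hdiv Ψ h0 hΨ _ _ hl t
      rw [lintegral_map hm.coe_nnreal_ennreal hmeas]
      have e1 := ofReal_integral_eq_lintegral_ofReal
        (μ := (volume : Measure (ι → ℂ)).restrict (tsupport g))
        (f := fun x => ((thickenedIndicator (hpos n) F x : NNReal) : ℝ))
        (hl.continuous.continuousOn.integrableOn_compact hcomp)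
        (Filter.Eventually.of_forall fun x => NNReal.coe_nonneg _)
      have e2 := ofReal_integral_eq_lintegral_ofReal
        (μ := (volume : Measure (ι → ℂ)).restrict (tsupport g))
        (f := fun x => ((thickenedIndicator (hpos n) F (Ψ t x) : NNReal) : ℝ))
        ((hl.continuous.comp hD.continuous).continuousOn.integrableOn_compact hcomp)
        (Filter.Eventually.of_forall fun x => NNReal.coe_nonneg _)
      simp only [ENNReal.ofReal_coe_nnreal] at e1 e2
      rw [← e1, ← e2, key]
    · rw [Measure.map_apply hmeas MeasurableSet.univ, Set.preimage_univ]
  have hfix : ∀ x, x ∉ tsupport g → Ψ t x = x := by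
    intro x hx
    have := al_unique g k hk (fun s => Ψ s x) (fun _ => x) (hΨ x)
      (fun s => by rw [image_eq_zero_of_notMem_tsupport hx]; exact hasDerivAt_const _ _) (h0 x)
    exact congrFun this t
  have hS : MeasurableSet (tsupport g) := (isClosed_tsupport g).measurableSet
  rw [← measure_inter_add_sdiff (Ψ t ⁻¹' A) hS, ← measure_inter_add_sdiff A hS]
  congr 1
  · have := congrArg (fun m => m A) hmap
    rwa [Measure.map_apply hmeas hA, Measure.restrict_apply (hmeas hA),
      Measure.restrict_apply hA] at this
  · congr 1
    ext x
    simp only [Set.mem_sdiff, Set.mem_preimage]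
    constructor
    · rintro ⟨h1, h2⟩; rw [hfix x h2] at h1; exact ⟨h1, h2⟩
    · rintro ⟨h1, h2⟩; rw [hfix x h2]; exact ⟨h1, h2⟩

end liouville

section concrete
variable {K : ℤ}

def alE (m : ℤ) : (IdxK K → ℂ) →L[ℝ] ℂ :=
  if h : m ∈ Finset.Icc (-K) K then ContinuousLinearMap.proj ⟨m, h⟩ else 0

theorem alE_apply (m : ℤ) (v : IdxK K → ℂ) : alE m v = extK v m := by
  unfold alE extK
  split_ifs <;> simp

def alS (n : IdxK K) : (IdxK K → ℂ) →L[ℝ] ℂ := alE (n.val + 1) + alE (n.val - 1)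

theorem alS_apply (n : IdxK K) (v : IdxK K → ℂ) :
    alS n v = extK v (n.val + 1) + extK v (n.val - 1) := by
  simp [alS, alE_apply]

theorem alS_single (n : IdxK K) (w : ℂ) : alS n (Pi.single n w) = 0 := by
  rw [alS_apply]
  have : ∀ m : ℤ, m ≠ n.val → extK (Pi.single n w : IdxK K → ℂ) m = 0 := by
    intro m hm
    unfold extK
    split_ifs with h
    · rw [Pi.single_eq_of_ne]
      intro h'
      exact hm (congrArg Subtype.val h')
    · rfl
  rw [this _ (by lia), this _ (by lia), add_zero]

def alRe (n : IdxK K) : (IdxK K → ℂ) →L[ℝ] ℝ :=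
  Complex.reCLM.comp (ContinuousLinearMap.proj n)
def alIm (n : IdxK K) : (IdxK K → ℂ) →L[ℝ] ℝ :=
  Complex.imCLM.comp (ContinuousLinearMap.proj n)

@[simp] theorem alRe_apply (n : IdxK K) (v : IdxK K → ℂ) : alRe n v = (v n).re := rfl
@[simp] theorem alIm_apply (n : IdxK K) (v : IdxK K → ℂ) : alIm n v = (v n).im := rfl

/-- squared modulus of a coordinate -/
def alN (n : IdxK K) (v : IdxK K → ℂ) : ℝ := 1 + Complex.normSq (v n)

theorem alN_one_le (n : IdxK K) (v : IdxK K → ℂ) : 1 ≤ alN n v := by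
  have := Complex.normSq_nonneg (v n)
  unfold alN; linarith

theorem alN_pos (n : IdxK K) (v : IdxK K → ℂ) : 0 < alN n v := by
  linarith [alN_one_le n v]

def alDN (n : IdxK K) (v : IdxK K → ℂ) : (IdxK K → ℂ) →L[ℝ] ℝ :=
  (2 * (v n).re) • alRe n + (2 * (v n).im) • alIm n

theorem alN_hasFDerivAt (n : IdxK K) (v : IdxK K → ℂ) : HasFDerivAt (alN n) (alDN n v) v := by
  have h1 : HasFDerivAt (fun v => alRe n v) (alRe n) v := (alRe n).hasFDerivAt
  have h2 : HasFDerivAt (fun v => alIm n v) (alIm n) v := (alIm n).hasFDerivAt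
  have := ((h1.mul h1).add (h2.mul h2)).const_add 1
  have e : alN n = fun v : IdxK K → ℂ => 1 + (alRe n v * alRe n v + alIm n v * alIm n v) := by
    ext v; simp [alN, Complex.normSq_apply]
  rw [e]
  refine this.congr_fderiv ?_
  ext w
  simp [alDN]
  ring

theorem alN_contDiff (n : IdxK K) : ContDiff ℝ 1 (alN n) := by
  have e : alN n = fun v : IdxK K → ℂ => 1 + (alRe n v * alRe n v + alIm n v * alIm n v) := by
    ext v; simp [alN, Complex.normSq_apply]
  rw [e]
  exact contDiff_const.add (((alRe n).contDiff.mul (alRe n).contDiff).add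
    ((alIm n).contDiff.mul (alIm n).contDiff))

/-- vector field -/
def alF (v : IdxK K → ℂ) : IdxK K → ℂ := fun n =>
  alN n v • (Complex.I * alS n v) - 2 * Complex.I * v n

def alQ (v : IdxK K → ℂ) : ℝ := ∑ n, Real.log (alN n v)

def alDQ (v : IdxK K → ℂ) : (IdxK K → ℂ) →L[ℝ] ℝ := ∑ n, (alN n v)⁻¹ • alDN n v

theorem alQ_hasFDerivAt (v : IdxK K → ℂ) : HasFDerivAt alQ (alDQ v) v :=
  HasFDerivAt.fun_sum fun n _ => (alN_hasFDerivAt n v).log (alN_pos n v).ne'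

theorem alQ_contDiff : ContDiff ℝ 1 (alQ (K := K)) :=
  ContDiff.sum fun n _ => (alN_contDiff n).log fun v => (alN_pos n v).ne'

def alDF (v : IdxK K → ℂ) (n : IdxK K) : (IdxK K → ℂ) →L[ℝ] ℂ :=
  (alN n v • ((ContinuousLinearMap.mul ℝ ℂ Complex.I).comp (alS n))
    + (alDN n v).smulRight (Complex.I * alS n v))
  - (ContinuousLinearMap.mul ℝ ℂ (2 * Complex.I)).comp (ContinuousLinearMap.proj n)

theorem alF_hasFDerivAt (v : IdxK K → ℂ) (n : IdxK K) :
    HasFDerivAt (fun v => alF v n) (alDF v n) v := by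
  have h1 : HasFDerivAt (fun v => Complex.I * alS n v)
      ((ContinuousLinearMap.mul ℝ ℂ Complex.I).comp (alS n)) v :=
    ((ContinuousLinearMap.mul ℝ ℂ Complex.I).comp (alS n)).hasFDerivAt
  have h2 : HasFDerivAt (fun v : IdxK K → ℂ => 2 * Complex.I * v n)
      ((ContinuousLinearMap.mul ℝ ℂ (2 * Complex.I)).comp (ContinuousLinearMap.proj n)) v :=
    ((ContinuousLinearMap.mul ℝ ℂ (2 * Complex.I)).comp
      (ContinuousLinearMap.proj (R := ℝ) (φ := fun _ : IdxK K => ℂ) n)).hasFDerivAt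
  exact ((alN_hasFDerivAt n v).smul h1).sub h2

theorem alF_contDiff : ContDiff ℝ 1 (alF (K := K)) := by
  rw [contDiff_pi]
  intro n
  have h1 : ContDiff ℝ 1 (fun v => Complex.I * alS n v) :=
    ((ContinuousLinearMap.mul ℝ ℂ Complex.I).comp (alS n)).contDiff
  have h2 : ContDiff ℝ 1 (fun v : IdxK K → ℂ => 2 * Complex.I * v n) :=
    ((ContinuousLinearMap.mul ℝ ℂ (2 * Complex.I)).comp
      (ContinuousLinearMap.proj (R := ℝ) (φ := fun _ : IdxK K => ℂ) n)).contDiff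
  exact ((alN_contDiff n).smul h1).sub h2

theorem al_cancel (v : IdxK K → ℂ) :
    ∑ n : IdxK K, (2 * (v n).im * (alS n v).re - 2 * (v n).re * (alS n v).im) = 0 := by
  let e : ℤ → ℂ := extK v
  have he : ∀ n : IdxK K, v n = e n.val := fun n => by
    have := n.2
    simp only [e, extK]
    rw [dif_pos this]
  let h : ℤ → ℝ := fun m => 2 * (e m).im * (e (m + 1)).re - 2 * (e m).re * (e (m + 1)).im
  have h1 : ∀ n : IdxK K, 2 * (v n).im * (alS n v).re - 2 * (v n).re * (alS n v).im
      = h n.val - h (n.val - 1) := by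
    intro n
    rw [alS_apply, he n]
    simp only [h, Complex.add_re, Complex.add_im, sub_add_cancel]
    change _ * ((e (n.val+1)).re + (e (n.val-1)).re) - _ * ((e (n.val+1)).im + (e (n.val-1)).im) = _
    ring
  have hz : ∀ m, m ∉ Finset.Icc (-K) K → e m = 0 := fun m hm => by
    simp only [e, extK]; rw [dif_neg hm]
  simp_rw [h1]
  rw [Finset.sum_coe_sort (Finset.Icc (-K) K) (fun m => h m - h (m - 1)), Finset.sum_sub_distrib,
    sub_eq_zero]
  have a1 : ∑ m ∈ Finset.Icc (-K) K, h m = ∑ m ∈ Finset.Icc (-K-1) K, h m := by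
    refine Finset.sum_subset (fun m hm => ?_) (fun m _ hm => ?_)
    · simp only [Finset.mem_Icc] at hm ⊢; lia
    · simp [h, hz m hm]
  have a2 : ∑ m ∈ Finset.Icc (-K) K, h (m - 1) = ∑ m ∈ Finset.Icc (-K-1) (K-1), h m := by
    refine Finset.sum_nbij' (fun m => m - 1) (fun m => m + 1) ?_ ?_ ?_ ?_ ?_
    · intro m hm; simp only [Finset.mem_Icc] at hm ⊢; lia
    · intro m hm; simp only [Finset.mem_Icc] at hm ⊢; lia
    · intro m _; simp
    · intro m _; simp
    · intro m _; rfl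
  have a3 : ∑ m ∈ Finset.Icc (-K-1) (K-1), h m = ∑ m ∈ Finset.Icc (-K-1) K, h m := by
    refine Finset.sum_subset (fun m hm => ?_) (fun m hm hm' => ?_)
    · simp only [Finset.mem_Icc] at hm ⊢; lia
    · have : e (m + 1) = 0 := hz _ (by simp only [Finset.mem_Icc] at hm hm' ⊢; lia)
      simp [h, this]
  rw [a1, a2, a3]

theorem alDQ_alF (v : IdxK K → ℂ) : alDQ v (alF v) = 0 := by
  rw [← al_cancel v]
  simp only [alDQ, ContinuousLinearMap.sum_apply]
  refine Finset.sum_congr rfl fun n _ => ?_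
  have := (alN_pos n v).ne'
  simp [alDN, alF]
  field_simp
  ring

theorem alDF_div (v : IdxK K → ℂ) :
    ∑ n, ((alDF v n (Pi.single n 1)).re + (alDF v n (Pi.single n Complex.I)).im) = 0 := by
  rw [← al_cancel v]
  refine Finset.sum_congr rfl fun n _ => ?_
  simp [alDF, alS_single, alDN]
  ring

/-- truncated vector field -/
def alG (R : ℝ) (v : IdxK K → ℂ) : IdxK K → ℂ := Real.smoothTransition (R + 1 - alQ v) • alF v

theorem alG_contDiff (R : ℝ) : ContDiff ℝ 1 (alG (K := K) R) := by
  have : ContDiff ℝ 1 fun v : IdxK K → ℂ => Real.smoothTransition (R + 1 - alQ v) :=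
    Real.smoothTransition.contDiff.comp (contDiff_const.sub alQ_contDiff)
  exact this.smul alF_contDiff

theorem alN_le_exp (n : IdxK K) (v : IdxK K → ℂ) : alN n v ≤ Real.exp (alQ v) := by
  rw [← Real.log_le_iff_le_exp (alN_pos n v)]
  exact Finset.single_le_sum (f := fun n => Real.log (alN n v))
    (fun m _ => Real.log_nonneg (alN_one_le m v)) (Finset.mem_univ n)

theorem alG_compact (R : ℝ) : HasCompactSupport (alG (K := K) R) := by
  refine HasCompactSupport.of_support_subset_isCompact
    (isCompact_closedBall (0 : IdxK K → ℂ) (Real.exp (R + 1))) ?_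
  intro v hv
  rw [Function.mem_support] at hv
  have hQ : alQ v ≤ R + 1 := by
    by_contra hcon
    apply hv
    unfold alG
    rw [Real.smoothTransition.zero_of_nonpos (by linarith), zero_smul]
  rw [mem_closedBall_zero_iff, pi_norm_le_iff_of_nonneg (Real.exp_pos _).le]
  intro n
  have h1 := alN_le_exp n v
  have h2 := Real.exp_le_exp.mpr hQ
  have h3 : alN n v = 1 + ‖v n‖ ^ 2 := by rw [alN, Complex.normSq_eq_norm_sq]
  nlinarith [sq_nonneg (‖v n‖ - 1), norm_nonneg (v n)]

theorem alG_div (R : ℝ) (v : IdxK K → ℂ) :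
    ∑ n, ((fderiv ℝ (alG R) v (Pi.single n 1) n).re
      + (fderiv ℝ (alG R) v (Pi.single n Complex.I) n).im) = 0 := by
  set θ : ℝ → ℝ := fun q => Real.smoothTransition (R + 1 - q) with hθ
  have hθd : HasDerivAt θ (deriv θ (alQ v)) (alQ v) := by
    have : ContDiff ℝ 1 θ :=
      Real.smoothTransition.contDiff.comp (contDiff_const.sub contDiff_id)
    exact ((this.differentiable (by simp)) _).hasDerivAt
  set c := deriv θ (alQ v)
  have hθQ : HasFDerivAt (fun v => θ (alQ v)) (c • alDQ v) v :=
    hθd.comp_hasFDerivAt v (alQ_hasFDerivAt v)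
  have hcomp : ∀ n w, fderiv ℝ (alG R) v w n
      = θ (alQ v) • alDF v n w + (c * alDQ v w) • alF v n := by
    intro n w
    have h1 : HasFDerivAt (fun v => alG R v n)
        (θ (alQ v) • alDF v n + (c • alDQ v).smulRight (alF v n)) v :=
      hθQ.smul (alF_hasFDerivAt v n)
    have h2 : HasFDerivAt (fun v => alG R v n)
        ((ContinuousLinearMap.proj n).comp (fderiv ℝ (alG R) v)) v :=
      (ContinuousLinearMap.proj (R := ℝ) (φ := fun _ : IdxK K => ℂ) n).hasFDerivAt.comp v
        (((alG_contDiff R).differentiable (by simp)) v).hasFDerivAt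
    have := congrArg (fun T => T w) (h1.unique h2)
    simpa using this.symm
  have e1 := alDF_div v
  have e2 := alDQ_alF v
  rw [al_decomp (alF v), map_sum] at e2
  calc _ = ∑ n, (θ (alQ v) * ((alDF v n (Pi.single n 1)).re
            + (alDF v n (Pi.single n Complex.I)).im)
          + c * alDQ v ((alF v n).re • (Pi.single n (1:ℂ) : IdxK K → ℂ)
            + (alF v n).im • (Pi.single n Complex.I : IdxK K → ℂ))) := by
        refine Finset.sum_congr rfl fun n _ => ?_
        rw [hcomp, hcomp, map_add, map_smul, map_smul]
        simp only [Complex.add_re, Complex.add_im, Complex.real_smul, Complex.re_ofReal_mul,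
          Complex.im_ofReal_mul, smul_eq_mul]
        ring
    _ = 0 := by
        rw [Finset.sum_add_distrib, ← Finset.mul_sum, ← Finset.mul_sum, e1, e2]
        ring

theorem al_conserve (γ : ℝ → (IdxK K → ℂ)) (c : ℝ → ℝ)
    (hγ : ∀ t, HasDerivAt γ (c t • alF (γ t)) t) (t : ℝ) : alQ (γ t) = alQ (γ 0) := by
  have hd : ∀ s, HasDerivAt (fun s => alQ (γ s)) 0 s := by
    intro s
    have := (alQ_hasFDerivAt (γ s)).comp_hasDerivAt s (hγ s)
    rw [map_smul, alDQ_alF, smul_zero] at this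
    exact this
  exact is_const_of_deriv_eq_zero (fun s => (hd s).differentiableAt) (fun s => (hd s).deriv) t 0

theorem alG_eq (R : ℝ) (v : IdxK K → ℂ) (h : alQ v ≤ R) : alG R v = alF v := by
  unfold alG
  rw [Real.smoothTransition.one_of_one_le (by linarith), one_smul]

theorem alF_solves_alG (R : ℝ) (γ : ℝ → (IdxK K → ℂ))
    (hγ : ∀ t, HasDerivAt γ (alF (γ t)) t) (hR : alQ (γ 0) ≤ R) (t : ℝ) :
    HasDerivAt γ (alG R (γ t)) t := by
  have := al_conserve γ (fun _ => 1) (fun t => by simpa using hγ t) t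
  rw [alG_eq R _ (by linarith)]
  exact hγ t

theorem al_flow (K : ℤ) (R : ℝ) : ∃ Ψ : ℝ → (IdxK K → ℂ) → (IdxK K → ℂ),
    (∀ x, Ψ 0 x = x) ∧ (∀ t x, alQ (Ψ t x) = alQ x) ∧
    (∀ x, alQ x ≤ R → ∀ t, HasDerivAt (fun s => Ψ s x) (alF (Ψ t x)) t) ∧
    (∀ γ : ℝ → (IdxK K → ℂ), (∀ t, HasDerivAt γ (alF (γ t)) t) → alQ (γ 0) ≤ R →
      ∀ t, γ t = Ψ t (γ 0)) ∧
    (∀ t, Continuous (Ψ t)) ∧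
    (∀ t A, MeasurableSet A → volume (Ψ t ⁻¹' A) = volume A) := by
  have hg := alG_contDiff (K := K) R
  have hc := alG_compact (K := K) R
  obtain ⟨k, hk⟩ := hg.lipschitzWith_of_hasCompactSupport hc (by simp)
  obtain ⟨L, hL⟩ := hc.exists_bound_of_continuous hg.continuous
  have hex := al_global_exists (alG (K := K) R) k L.toNNReal hk
    (fun x => (hL x).trans (Real.le_coe_toNNReal L))
  choose γ h0 hγ using hex
  have hQ : ∀ t x, alQ (γ x t) = alQ x := fun t x => by
    have := al_conserve (γ x) (fun t => Real.smoothTransition (R + 1 - alQ (γ x t))) (hγ x) t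
    rw [this, h0]
  have hlv := al_liouville (alG (K := K) R) hg hc (alG_div R) (fun t x => γ x t) h0 hγ
  refine ⟨fun t x => γ x t, h0, hQ, ?_, ?_, fun t => (hlv t).1, fun t => (hlv t).2⟩
  · intro x hx t
    have := hγ x t
    rwa [alG_eq R _ (by rw [hQ]; exact hx)] at this
  · intro η hη hR t
    exact congrFun (al_unique _ k hk η (γ (η 0)) (alF_solves_alG R η hη hR) (hγ _)
      (h0 _).symm) t

theorem al_eqn_iff (α : ℝ → (IdxK K → ℂ)) :
    TruncALEquation K α ↔ ∀ t, HasDerivAt α (alF (α t)) t := by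
  have key : ∀ (n : IdxK K) (t : ℝ) (d : ℂ), (Complex.I * d
      = -(1 + (Complex.normSq (α t n) : ℂ)) * (extK (α t) (n.val + 1) + extK (α t) (n.val - 1))
        + 2 * α t n) ↔ d = alF (α t) n := by
    intro n t d
    simp only [alF, alS_apply, alN, Complex.real_smul, Complex.ofReal_add, Complex.ofReal_one]
    constructor
    · intro h
      linear_combination (-Complex.I) * h + d * Complex.I_mul_I
    · rintro rfl
      linear_combination ((1 + (Complex.normSq (α t n) : ℂ)) *
        (extK (α t) (n.val + 1) + extK (α t) (n.val - 1)) - 2 * α t n) * Complex.I_mul_I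
  constructor
  · intro h t
    rw [hasDerivAt_pi]
    intro n
    obtain ⟨d, hd, he⟩ := h n t
    rw [key] at he
    rwa [he] at hd
  · intro h n t
    exact ⟨_, (hasDerivAt_pi.mp (h t)) n, (key n t _).mpr rfl⟩

theorem al_density (β : ℝ) (v : IdxK K → ℂ) :
    (∏ n : IdxK K,
      ENNReal.ofReal ((1 + 2*β)/(Real.pi * (1 + Complex.normSq (v n)) ^ (2 + 2*β))))
    = (∏ _n : IdxK K, ENNReal.ofReal ((1 + 2*β)/Real.pi)) *
      ENNReal.ofReal (Real.exp (-(2 + 2*β) * alQ v)) := by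
  rw [alQ, Finset.mul_sum, Real.exp_sum, ENNReal.ofReal_prod_of_nonneg
    (fun n _ => (Real.exp_pos _).le), ← Finset.prod_mul_distrib]
  refine Finset.prod_congr rfl fun n _ => ?_
  rw [← ENNReal.ofReal_mul' (Real.exp_pos _).le]
  congr 1
  have hp := alN_pos n v
  change (1 + 2*β)/(Real.pi * (alN n v) ^ (2 + 2*β)) = _
  rw [mul_comm (-(2 + 2 * β)), ← Real.rpow_def_of_pos hp, Real.rpow_neg hp.le]
  have := (Real.rpow_pos_of_pos hp (2 + 2 * β)).ne'
  field_simp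

end concrete

/-- (i) global well-posedness of the truncated Ablowitz–Ladik system on
ℂ^{{−K,…,K}}; (ii) the flow maps leave the measure μ_wn^{β,K} invariant. -/
theorem truncated_AL_wellposed_and_invariant (K : ℤ) (hK : 1 ≤ K) (β : ℝ) (hβ : 0 < β) :
    (∀ a : IdxK K → ℂ,
      ∃! α : ℝ → (IdxK K → ℂ), ContDiff ℝ 1 α ∧ α 0 = a ∧ TruncALEquation K α) ∧
    (∀ Φ : ℝ → (IdxK K → ℂ) → (IdxK K → ℂ),
      (∀ a : IdxK K → ℂ,
        ContDiff ℝ 1 (fun t => Φ t a) ∧ Φ 0 a = a ∧ TruncALEquation K (fun t => Φ t a)) →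
      ∀ t : ℝ, (muWnK β K).map (Φ t) = muWnK β K) := by
  constructor
  · intro a
    obtain ⟨Ψ, h0, hQ, hd, hu, -, -⟩ := al_flow K (alQ a)
    have hda := hd a le_rfl
    refine ⟨fun t => Ψ t a, ⟨?_, h0 a, (al_eqn_iff _).mpr hda⟩, ?_⟩
    · rw [contDiff_one_iff_deriv]
      refine ⟨fun t => (hda t).differentiableAt, ?_⟩
      have : deriv (fun t => Ψ t a) = fun t => alF (Ψ t a) := funext fun t => (hda t).deriv
      rw [this]
      exact alF_contDiff.continuous.comp
        (continuous_iff_continuousAt.mpr fun t => (hda t).continuousAt)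
    · rintro η ⟨-, hη0, hη⟩
      ext1 t
      rw [hu η ((al_eqn_iff η).mp hη) (by rw [hη0]) t, hη0]
  · intro Φ hΦ t
    have hΦ0 : ∀ a, Φ 0 a = a := fun a => (hΦ a).2.1
    have hΦd : ∀ a s, HasDerivAt (fun r => Φ r a) (alF (Φ s a)) s := fun a =>
      (al_eqn_iff _).mp (hΦ a).2.2
    choose Ψ h0 hQ hd hu hcont hvol using fun R => al_flow K R
    have heq : ∀ (R : ℝ) x, alQ x ≤ R → Φ t x = Ψ R t x := by
      intro R x hx
      have := hu R (fun r => Φ r x) (hΦd x) (by simpa only [hΦ0] using hx) t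
      simpa only [hΦ0] using this
    have hΦQ : ∀ x, alQ (Φ t x) = alQ x := fun x => by rw [heq _ x le_rfl, hQ]
    have hQc : Continuous (alQ (K := K)) := alQ_contDiff.continuous
    have hΦc : Continuous (Φ t) := by
      rw [continuous_iff_continuousAt]
      intro x
      refine (hcont (alQ x + 1) t).continuousAt.congr ?_
      have : ∀ᶠ y in nhds x, alQ y < alQ x + 1 :=
        hQc.continuousAt.eventually (gt_mem_nhds (by linarith))
      filter_upwards [this] with y hy
      exact (heq _ y hy.le).symm
    have hvolΦ : ∀ A, MeasurableSet A → volume (Φ t ⁻¹' A) = volume A := by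
      intro A hA
      let S : ℕ → Set (IdxK K → ℂ) := fun n => {x | alQ x ≤ n}
      have hSm : ∀ n, MeasurableSet (S n) := fun n =>
        (isClosed_le hQc continuous_const).measurableSet
      have hSmono : Monotone S := fun m n hmn x hx => by
        have : (m : ℝ) ≤ n := by exact_mod_cast hmn
        exact le_trans hx this
      have hSU : ⋃ n, S n = Set.univ := by
        ext x
        simpa [S] using exists_nat_ge (alQ x)
      have hstep : ∀ n, volume (Φ t ⁻¹' (A ∩ S n)) = volume (A ∩ S n) := by
        intro n
        rw [← hvol n t _ (hA.inter (hSm n))]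
        congr 1
        ext x
        simp only [Set.mem_preimage, Set.mem_inter_iff, S, Set.mem_setOf_eq, hQ, hΦQ]
        constructor <;> rintro ⟨h1, h2⟩ <;> refine ⟨?_, h2⟩
        · rwa [← heq n x h2]
        · rwa [heq n x h2]
      have m1 : Monotone fun n => A ∩ S n := fun m n h => Set.inter_subset_inter_right _ (hSmono h)
      have e1 : A = ⋃ n, (A ∩ S n) := by rw [← Set.inter_iUnion, hSU, Set.inter_univ]
      rw [e1, Set.preimage_iUnion, m1.measure_iUnion,
        Monotone.measure_iUnion (fun m n h => Set.preimage_mono (m1 h))]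
      simp_rw [hstep]
    have hmp : MeasurePreserving (Φ t) (volume : Measure (IdxK K → ℂ)) volume := by
      refine ⟨hΦc.measurable, Measure.ext fun A hA => ?_⟩
      rw [Measure.map_apply hΦc.measurable hA, hvolΦ A hA]
    unfold muWnK
    simp_rw [al_density]
    have hρm : Measurable fun v : IdxK K → ℂ =>
        (∏ _n : IdxK K, ENNReal.ofReal ((1 + 2*β)/Real.pi)) *
          ENNReal.ofReal (Real.exp (-(2 + 2*β) * alQ v)) :=
      ((Real.continuous_exp.comp (continuous_const.mul hQc)).measurable.ennreal_ofReal).const_mul _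
    refine Measure.ext fun A hA => ?_
    rw [Measure.map_apply hΦc.measurable hA, withDensity_apply _ hA,
      withDensity_apply _ (hΦc.measurable hA),
      ← hmp.setLIntegral_comp_preimage hA hρm]
    simp_rw [hΦQ]
end
end

section
/- Let S : ℤ → 𝕊² be a sequence of spins with S_n·S_{n+1} ≠ −1 for all n ∈ ℤ, and let P₀ ∈ SO(3) satisfy S₀ = P₀e₃. Then there exists a unique sequence (α_n)_{n∈ℤ} of complex numbers such that, defining P_n ∈ SO(3) for all n ∈ ℤ by the recursion P_{n+1} = P_n Q(α_n) (equivalently, P_n = P_{n+1} Q(α_n)ᵀ for n < 0), one has S_n = P_n e₃ for all n ∈ ℤ. Moreover, for all n ∈ ℤ: S_n·S_{n+1} = (1−|α_n|²)/(1+|α_n|²), and (S_{n−1}×S_n)·(S_n×S_{n+1}) + i S_{n−1}·(S_n×S_{n+1}) = 4·conj(α_n)·α_{n−1} / ((1+|α_n|²)(1+|α_{n−1}|²)). -/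
open Matrix
noncomputable section

/-- 3×3 real matrices. -/
abbrev Mat3 := Matrix (Fin 3) (Fin 3) ℝ

/-- Membership in SO(3): orthogonal with determinant 1. -/
def IsSO3 (M : Mat3) : Prop := M * Mᵀ = 1 ∧ M.det = 1

/-- The vector e₃ = (0,0,1). -/
def e3 : Fin 3 → ℝ := ![0, 0, 1]

/-- The matrix Q(z) = (1/(1+|z|²)) [[1−Re z², Im z², 2Re z], [Im z², 1+Re z², −2Im z],
[−2Re z, 2Im z, 1−|z|²]]. -/
def Qmat (z : ℂ) : Mat3 :=
  (1/(1 + Complex.normSq z)) •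
    !![1 - (z^2).re, (z^2).im, 2*z.re;
       (z^2).im, 1 + (z^2).re, -(2*z.im);
       -(2*z.re), 2*z.im, 1 - Complex.normSq z]

lemma pf_pos (z : ℂ) : 1 + Complex.normSq z ≠ 0 := by
  have := Complex.normSq_nonneg z
  positivity

lemma Q_transpose (z : ℂ) : (Qmat z)ᵀ = Qmat (-z) := by
  ext i j
  fin_cases i <;> fin_cases j <;> simp [Qmat]

lemma Q_mul_transpose (z : ℂ) : Qmat z * (Qmat z)ᵀ = 1 := by
  have h := pf_pos z
  rw [Complex.normSq_apply] at h
  ext i j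
  fin_cases i <;> fin_cases j <;>
    simp [Qmat, Matrix.mul_apply, Fin.sum_univ_three, pow_two, Complex.normSq_apply] <;>
    field_simp <;> ring

lemma Q_det (z : ℂ) : (Qmat z).det = 1 := by
  have h := pf_pos z
  rw [Complex.normSq_apply] at h
  simp [Qmat, Matrix.det_fin_three, pow_two, Complex.normSq_apply]
  field_simp
  ring

lemma Q_SO3 (z : ℂ) : IsSO3 (Qmat z) := ⟨Q_mul_transpose z, Q_det z⟩

lemma SO3_mul {A B : Mat3} (hA : IsSO3 A) (hB : IsSO3 B) : IsSO3 (A * B) := by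
  refine ⟨?_, by rw [det_mul, hA.2, hB.2, one_mul]⟩
  rw [transpose_mul, Matrix.mul_assoc, ← Matrix.mul_assoc B, hB.1, Matrix.one_mul, hA.1]

lemma SO3_transpose {A : Mat3} (hA : IsSO3 A) : IsSO3 Aᵀ := by
  refine ⟨?_, by rw [det_transpose, hA.2]⟩
  rw [transpose_transpose]
  exact mul_eq_one_comm.mp hA.1

lemma SO3_dot {A : Mat3} (hA : IsSO3 A) (u v : Fin 3 → ℝ) : (A *ᵥ u) ⬝ᵥ (A *ᵥ v) = u ⬝ᵥ v := by
  rw [dotProduct_mulVec, vecMul_mulVec, mul_eq_one_comm.mp hA.1, vecMul_one]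

lemma SO3_triple {A : Mat3} (hA : IsSO3 A) (u v w : Fin 3 → ℝ) :
    (A *ᵥ u) ⬝ᵥ (crossProduct (A *ᵥ v) (A *ᵥ w)) = u ⬝ᵥ crossProduct v w := by
  have h : (A *ᵥ u) ⬝ᵥ (crossProduct (A *ᵥ v) (A *ᵥ w)) = A.det * (u ⬝ᵥ crossProduct v w) := by
    simp [Matrix.det_fin_three, cross_apply, Matrix.mulVec, dotProduct, Fin.sum_univ_three]
    ring
  rw [h, hA.2, one_mul]

lemma SO3_cancel {A : Mat3} (hA : IsSO3 A) {u v : Fin 3 → ℝ} (h : A *ᵥ u = A *ᵥ v) : u = v := by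
  have := congrArg (fun x => Aᵀ *ᵥ x) h
  simpa [mulVec_mulVec, mul_eq_one_comm.mp hA.1] using this

lemma Q_e3 (z : ℂ) : Qmat z *ᵥ e3 = ![2 * z.re / (1 + Complex.normSq z),
    -(2 * z.im) / (1 + Complex.normSq z), (1 - Complex.normSq z) / (1 + Complex.normSq z)] := by
  ext i
  fin_cases i <;> simp [Qmat, e3, Matrix.mulVec, dotProduct, Fin.sum_univ_three] <;> ring

lemma Q_e3_inj {z w : ℂ} (h : Qmat z *ᵥ e3 = Qmat w *ᵥ e3) : z = w := by
  have hz := pf_pos z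
  have hw := pf_pos w
  rw [Q_e3, Q_e3] at h
  have h0 := congrFun h 0
  have h1 := congrFun h 1
  have h2 := congrFun h 2
  simp at h0 h1 h2
  have h3 : Complex.normSq z = Complex.normSq w := by
    field_simp at h2
    linarith
  rw [h3] at h0 h1
  field_simp at h0 h1
  apply Complex.ext <;> linarith

lemma Q_e3_surj (w : Fin 3 → ℝ) (h : w ⬝ᵥ w = 1) (h2 : w 2 ≠ -1) : ∃ z, Qmat z *ᵥ e3 = w := by
  have h3 : 1 + w 2 ≠ 0 := fun h => h2 (by linarith)
  simp [dotProduct, Fin.sum_univ_three] at h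
  refine ⟨⟨w 0 / (1 + w 2), - w 1 / (1 + w 2)⟩, ?_⟩
  have hN : Complex.normSq ⟨w 0 / (1 + w 2), - w 1 / (1 + w 2)⟩ = (1 - w 2) / (1 + w 2) := by
    rw [Complex.normSq_apply]
    field_simp
    linarith
  have h4 : 1 + (1 - w 2) / (1 + w 2) = 2 / (1 + w 2) := by field_simp; ring
  rw [Q_e3, hN, h4]
  ext i
  fin_cases i <;> simp <;> field_simp
  ring

lemma pf_step {A : Mat3} (hA : IsSO3 A) (T : Fin 3 → ℝ) (hT : T ⬝ᵥ T = 1)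
    (h : (A *ᵥ e3) ⬝ᵥ T ≠ -1) : ∃ z, T = (A * Qmat z) *ᵥ e3 := by
  have hAT : A *ᵥ (Aᵀ *ᵥ T) = T := by rw [mulVec_mulVec, hA.1, one_mulVec]
  obtain ⟨z, hz⟩ := Q_e3_surj (Aᵀ *ᵥ T) (by rw [SO3_dot (SO3_transpose hA), hT]) (by
    rw [← hAT, SO3_dot hA] at h
    simpa [e3, dotProduct, Fin.sum_univ_three] using h)
  exact ⟨z, by rw [← mulVec_mulVec, hz, hAT]⟩

lemma pf_nat (T : ℕ → Fin 3 → ℝ) (hT : ∀ n, T n ⬝ᵥ T n = 1) (hne : ∀ n, T n ⬝ᵥ T (n+1) ≠ -1)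
    (P0 : Mat3) (hP0 : IsSO3 P0) (h0 : T 0 = P0 *ᵥ e3) :
    ∃ (β : ℕ → ℂ) (F : ℕ → Mat3), F 0 = P0 ∧ (∀ n, F (n+1) = F n * Qmat (β n)) ∧
      ∀ n, T n = F n *ᵥ e3 := by
  have key : ∀ (A : Mat3) (n : ℕ), ∃ z, IsSO3 A → T n = A *ᵥ e3 →
      T (n+1) = (A * Qmat z) *ᵥ e3 := by
    intro A n
    by_cases hA : IsSO3 A
    · by_cases hn : T n = A *ᵥ e3
      · obtain ⟨z, hz⟩ := pf_step hA (T (n+1)) (hT _) (hn ▸ hne n)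
        exact ⟨z, fun _ _ => hz⟩
      · exact ⟨0, fun _ h => absurd h hn⟩
    · exact ⟨0, fun h => absurd h hA⟩
  choose z hz using key
  let F : ℕ → Mat3 := fun n => Nat.rec P0 (fun n A => A * Qmat (z A n)) n
  have hF : ∀ n, IsSO3 (F n) ∧ T n = F n *ᵥ e3 := by
    intro n
    induction n with
    | zero => exact ⟨hP0, h0⟩
    | succ n ih => exact ⟨SO3_mul ih.1 (Q_SO3 _), hz _ _ ih.1 ih.2⟩
  exact ⟨fun n => z (F n) n, F, rfl, fun n => rfl, fun n => (hF n).2⟩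

lemma pf_back {A B : Mat3} {z : ℂ} (h : A = B * Qmat z) : B = A * Qmat (-z) := by
  rw [h, Matrix.mul_assoc, ← Q_transpose, Q_mul_transpose, Matrix.mul_one]

lemma pf_SO3 {α : ℤ → ℂ} {P : ℤ → Mat3} (h0 : IsSO3 (P 0))
    (hP : ∀ n : ℤ, P (n+1) = P n * Qmat (α n)) (n : ℤ) : IsSO3 (P n) := by
  induction n with
  | zero => exact h0
  | succ n ih => rw [hP]; exact SO3_mul ih (Q_SO3 _)
  | pred n ih =>
    have := hP (-(n:ℤ) - 1)
    rw [sub_add_cancel] at this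
    rw [pf_back this]
    exact SO3_mul ih (Q_SO3 _)

/-- existence and uniqueness of the parallel-frame coordinates (α_n), and the
formulas relating them to the spin configuration. -/
theorem parallel_frame_coordinates
    (S : ℤ → Fin 3 → ℝ)
    (hunit : ∀ n : ℤ, S n ⬝ᵥ S n = 1)
    (hne : ∀ n : ℤ, S n ⬝ᵥ S (n+1) ≠ -1)
    (P0 : Mat3) (hP0 : IsSO3 P0) (hS0 : S 0 = P0 *ᵥ e3) :
    (∃! α : ℤ → ℂ, ∃ P : ℤ → Mat3,
      P 0 = P0 ∧ (∀ n : ℤ, P (n+1) = P n * Qmat (α n)) ∧ (∀ n : ℤ, S n = P n *ᵥ e3)) ∧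
    (∀ (α : ℤ → ℂ) (P : ℤ → Mat3),
      P 0 = P0 → (∀ n : ℤ, P (n+1) = P n * Qmat (α n)) → (∀ n : ℤ, S n = P n *ᵥ e3) →
      ∀ n : ℤ,
        (S n ⬝ᵥ S (n+1)
          = (1 - Complex.normSq (α n))/(1 + Complex.normSq (α n))) ∧
        ((((crossProduct (S (n-1)) (S n)) ⬝ᵥ (crossProduct (S n) (S (n+1))) : ℝ) : ℂ)
            + ((S (n-1) ⬝ᵥ crossProduct (S n) (S (n+1)) : ℝ) : ℂ) * Complex.I
          = 4 * (starRingEnd ℂ) (α n) * α (n-1)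
              / (((1 + Complex.normSq (α n)) * (1 + Complex.normSq (α (n-1))) : ℝ) : ℂ))) := by
  refine ⟨?_, ?_⟩
  · apply existsUnique_of_exists_of_unique
    · obtain ⟨β, F, hF0, hF, hFS⟩ := pf_nat (fun n => S n) (fun n => hunit _)
        (fun n => by simpa using hne n) P0 hP0 (by simpa using hS0)
      obtain ⟨γ, G, hG0, hG, hGS⟩ := pf_nat (fun n => S (-n)) (fun n => hunit _)
        (fun n => by
          have := hne (-(n:ℤ) - 1)
          rw [sub_add_cancel, dotProduct_comm] at this
          have e : (-((n + 1 : ℕ) : ℤ)) = -(n:ℤ) - 1 := by push_cast; ring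
          simp only [e]
          exact this) P0 hP0 (by simpa using hS0)
      refine ⟨fun n => match n with
        | Int.ofNat k => β k
        | Int.negSucc k => - γ k, fun n => match n with
        | Int.ofNat k => F k
        | Int.negSucc k => G (k+1), hF0, ?_, ?_⟩
      · intro n
        match n with
        | Int.ofNat k => exact hF k
        | Int.negSucc 0 =>
          have := pf_back (hG 0)
          rw [hG0, ← hF0] at this
          exact this
        | Int.negSucc (k+1) => exact pf_back (hG (k+1))
      · intro n
        match n with
        | Int.ofNat k => exact hFS k
        | Int.negSucc k => exact hGS (k+1)
    · rintro α α' ⟨P, hP0', hP, hPS⟩ ⟨P', hP0'', hP', hPS'⟩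
      have hso := pf_SO3 (hP0' ▸ hP0) hP
      have hfw : ∀ n, P n = P' n → α n = α' n := by
        intro n hn
        apply Q_e3_inj
        apply SO3_cancel (hso n)
        rw [mulVec_mulVec, mulVec_mulVec, ← hP, hn, ← hP', ← hPS, ← hPS']
      have hbw : ∀ n, P (n+1) = P' (n+1) → α n = α' n := by
        intro n hn
        have e1 := pf_back (hP n)
        have e2 := pf_back (hP' n)
        apply neg_injective
        apply Q_e3_inj
        apply SO3_cancel (hso (n+1))
        rw [mulVec_mulVec, mulVec_mulVec, ← e1, hn, ← e2, ← hPS, ← hPS']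
      have hPP : ∀ n, P n = P' n := by
        intro n
        induction n with
        | zero => rw [hP0', hP0'']
        | succ n ih => rw [hP, hP', hfw _ ih, ih]
        | pred n ih =>
          have e := hbw (-(n:ℤ) - 1) (by rw [sub_add_cancel]; exact ih)
          have e1 := pf_back (hP (-(n:ℤ) - 1))
          have e2 := pf_back (hP' (-(n:ℤ) - 1))
          rw [sub_add_cancel] at e1 e2
          rw [e1, e2, e, ih]
      exact funext fun n => hfw n (hPP n)
  · intro α P hP0' hP hPS n
    have hso := pf_SO3 (hP0' ▸ hP0) hP
    have e1 : S (n+1) = P n *ᵥ (Qmat (α n) *ᵥ e3) := by rw [mulVec_mulVec, ← hP, hPS]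
    have e2 : S (n-1) = P n *ᵥ (Qmat (-α (n-1)) *ᵥ e3) := by
      have := pf_back (hP (n-1))
      rw [sub_add_cancel] at this
      rw [mulVec_mulVec, ← this, hPS]
    rw [e1, e2, hPS n, cross_dot_cross, SO3_triple (hso n)]
    simp only [SO3_dot (hso n)]
    rw [Q_e3, Q_e3]
    have ha := pf_pos (α n)
    have hb := pf_pos (α (n-1))
    generalize α n = a at *
    generalize α (n-1) = b at *
    refine ⟨by simp [e3, dotProduct, Fin.sum_univ_three], ?_⟩
    apply Complex.ext
    · rw [Complex.div_ofReal_re]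
      simp only [Complex.add_re, Complex.re_mul_ofReal, Complex.im_mul_ofReal, Complex.re_ofReal_mul, Complex.im_ofReal_mul, Complex.ofReal_re, Complex.ofReal_im, Complex.I_re, Complex.I_im]
      simp [e3, dotProduct, Fin.sum_univ_three, cross_apply]
      field_simp
      ring
    · rw [Complex.div_ofReal_im]
      simp only [Complex.add_im, Complex.re_mul_ofReal, Complex.im_mul_ofReal, Complex.re_ofReal_mul, Complex.im_ofReal_mul, Complex.ofReal_re, Complex.ofReal_im, Complex.I_re, Complex.I_im]
      simp [e3, dotProduct, Fin.sum_univ_three, cross_apply]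
      field_simp
      ring
end
end
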